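/- Let Ω ⊂ ℝ^d be an open set, r ∈ ℕ, k_1, …, k_r ∈ {1,…,d}, and for each i let T_i = \vec T_i ‖T_i‖ be a k_i-dimensional normal current on Ω. Let μ be a finite positive Radon measure on Ω with μ ≪ ‖T_i‖ for i = 1,…,r. Then for μ^s-almost every x ∈ Ω (μ^s being the singular part of μ with respect to ℒ^d) there exists a nonzero 1-covector ω_x ∈ Λ^1(ℝ^d) ∖ {0} such that \vec T_1(x) ⌟ ω_x = ⋯ = \vec T_r(x) ⌟ ω_x = 0; equivalently, \vec T_i(x) ∈ Λ_{k_i}(ker ω_x) for every i = 1,…,r. -/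

import Mathlib

open MeasureTheory Metric

/-- The partial derivative `∂_j φ` of a scalar function on `ℝ^d`. -/
noncomputable def pderiv' {d : ℕ} (j : Fin d) (φ : EuclideanSpace ℝ (Fin d) → ℝ) :
    EuclideanSpace ℝ (Fin d) → ℝ :=
  fun x => fderiv ℝ φ x (EuclideanSpace.single j 1)

/-- The sign `ε(j,t)` with `dx^j ∧ dx^t = ε(j,t) dx^{t ∪ {j}}` (for `j ∉ t`),
namely `(-1)` to the number of elements of `t` smaller than `j`. -/
def wedgeSign {d : ℕ} (j : Fin d) (t : Finset (Fin d)) : ℝ :=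
  (-1 : ℝ) ^ (t.filter fun l => l < j).card

namespace NormalCurrent

open Set Filter Topology ENNReal
open scoped ContDiff

variable {d : ℕ}

local notation "𝔼" => EuclideanSpace ℝ (Fin d)

/-- A smooth compactly supported curl-free field `V` on `ℝ^d` whose divergence is the difference
of two dilates of a nonnegative bump `ζ`. -/
structure FieldKernel (d : ℕ) where
  V : Fin d → EuclideanSpace ℝ (Fin d) → ℝ
  ζ : EuclideanSpace ℝ (Fin d) → ℝ
  smooth : ∀ k, ContDiff ℝ ∞ (V k)
  tsupport_subset : ∀ k, tsupport (V k) ⊆ closedBall 0 1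
  ζ_cont : Continuous ζ
  ζ_nonneg : ∀ x, 0 ≤ ζ x
  ζ_support : Function.support ζ ⊆ closedBall 0 1
  ζ_pos : 0 < ∫ x, ζ x
  symm : ∀ j k x, pderiv' j (V k) x = pderiv' k (V j) x
  div : ∀ x, ∑ k, pderiv' k (V k) x = 2 ^ d * ζ ((2 : ℝ) • x) - ζ x

/-- A smooth cutoff, equal to `1` on `(-∞, 1/4]` and to `0` on `[1, ∞)`. -/
noncomputable def cutoff (t : ℝ) : ℝ := Real.smoothTransition ((1 - t) * (4 / 3))

theorem contDiff_cutoff : ContDiff ℝ ∞ cutoff :=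
  Real.smoothTransition.contDiff.comp (by fun_prop)

theorem cutoff_of_le {t : ℝ} (h : t ≤ 1 / 4) : cutoff t = 1 :=
  Real.smoothTransition.one_of_one_le (by linarith)

theorem cutoff_of_ge {t : ℝ} (h : 1 ≤ t) : cutoff t = 0 :=
  Real.smoothTransition.zero_of_nonpos (by linarith)

theorem antitone_cutoff : Antitone cutoff := fun s t h =>
  Real.smoothTransition.monotone (by linarith)

theorem deriv_cutoff_nonpos (t : ℝ) : deriv cutoff t ≤ 0 := antitone_cutoff.deriv_nonpos

theorem deriv_cutoff_of_lt {t : ℝ} (h : t < 1 / 4) : deriv cutoff t = 0 := by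
  have : cutoff =ᶠ[𝓝 t] fun _ => 1 := by
    filter_upwards [Iio_mem_nhds h] with s hs using cutoff_of_le (le_of_lt hs)
  rw [this.deriv_eq]; simp

theorem deriv_cutoff_of_gt {t : ℝ} (h : 1 < t) : deriv cutoff t = 0 := by
  have : cutoff =ᶠ[𝓝 t] fun _ => 0 := by
    filter_upwards [Ioi_mem_nhds h] with s hs using cutoff_of_ge (le_of_lt hs)
  rw [this.deriv_eq]; simp

theorem exists_deriv_cutoff_neg : ∃ t > 0, deriv cutoff t < 0 := by
  obtain ⟨t, ht, h⟩ := exists_deriv_eq_slope cutoff (a := 1 / 4) (b := 1) (by norm_num)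
    contDiff_cutoff.continuous.continuousOn
    (contDiff_cutoff.differentiable (by simp)).differentiableOn
  refine ⟨t, by linarith [ht.1], ?_⟩
  rw [h, cutoff_of_ge le_rfl, cutoff_of_le le_rfl]; norm_num

/-- The radial profile of the field kernel. -/
noncomputable def profile (d : ℕ) (t : ℝ) : ℝ := t ^ (-(d : ℝ) / 2) * (cutoff t - cutoff (4 * t))

theorem profile_of_lt {t : ℝ} (h : t < 1 / 16) : profile d t = 0 := by
  rw [profile, cutoff_of_le (by linarith), cutoff_of_le (by linarith)]; simp

theorem profile_of_ge {t : ℝ} (h : 1 ≤ t) : profile d t = 0 := by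
  rw [profile, cutoff_of_ge (by linarith), cutoff_of_ge (by linarith)]; simp

theorem contDiff_profile : ContDiff ℝ ∞ (profile d) := by
  rw [contDiff_iff_contDiffAt]
  intro t
  rcases lt_or_ge t (1 / 16) with h | h
  · have : profile d =ᶠ[𝓝 t] fun _ => 0 := by
      filter_upwards [Iio_mem_nhds h] with s hs using profile_of_lt hs
    exact contDiffAt_const.congr_of_eventuallyEq this
  · have h0 : t ≠ 0 := by linarith
    exact (contDiffAt_id.rpow_const_of_ne h0).mul
      ((contDiff_cutoff.sub (contDiff_cutoff.comp (by fun_prop))).contDiffAt)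

theorem deriv_profile {t : ℝ} (ht : 0 < t) :
    2 * t * deriv (profile d) t + d * profile d t
      = 2 * t ^ (1 - (d : ℝ) / 2) * (deriv cutoff t - 4 * deriv cutoff (4 * t)) := by
  have hc : ∀ s, HasDerivAt cutoff (deriv cutoff s) s := fun s =>
    ((contDiff_cutoff.differentiable (by simp)) s).hasDerivAt
  have h4 : HasDerivAt (fun s => cutoff (4 * s)) (deriv cutoff (4 * t) * (4 * 1)) t :=
    (hc (4 * t)).comp t ((hasDerivAt_id t).const_mul 4)
  have h := ((Real.hasDerivAt_rpow_const (p := -(d : ℝ) / 2) (Or.inl ht.ne')).mul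
    ((hc t).sub h4)).deriv
  have h' : deriv (profile d) t = _ := h
  rw [h', profile]
  have e1 : t ^ (1 - (d : ℝ) / 2) = t * t ^ (-(d : ℝ) / 2) := by
    rw [show 1 - (d : ℝ) / 2 = 1 + -(d : ℝ) / 2 by ring, Real.rpow_add ht, Real.rpow_one]
  have e2 : t ^ (-(d : ℝ) / 2 - 1) = t ^ (-(d : ℝ) / 2) / t := by
    rw [Real.rpow_sub ht, Real.rpow_one]
  rw [e1, e2]
  simp only [Pi.sub_apply]
  field_simp
  ring

theorem pderiv'_profile (j k : Fin d) (x : 𝔼) :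
    pderiv' j (fun y : 𝔼 => profile d (‖y‖ ^ 2) * y k) x
      = 2 * deriv (profile d) (‖x‖ ^ 2) * x j * x k
        + profile d (‖x‖ ^ 2) * (if j = k then 1 else 0) := by
  have hp : HasDerivAt (profile d) (deriv (profile d) (‖x‖ ^ 2)) (‖x‖ ^ 2) :=
    ((contDiff_profile.differentiable (by simp)) _).hasDerivAt
  have h1 := hp.comp_hasFDerivAt x (hasStrictFDerivAt_norm_sq x).hasFDerivAt
  have h2 : HasFDerivAt (fun y : 𝔼 => y k) (EuclideanSpace.proj k : 𝔼 →L[ℝ] ℝ) x :=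
    (EuclideanSpace.proj k : 𝔼 →L[ℝ] ℝ).hasFDerivAt
  have h3 := (h1.mul h2).fderiv
  have h4 : pderiv' j (fun y : 𝔼 => profile d (‖y‖ ^ 2) * y k) x =
    fderiv ℝ ((profile d ∘ fun y : 𝔼 => ‖y‖ ^ 2) * fun y : 𝔼 => y k) x
      (EuclideanSpace.single j 1) := rfl
  rw [h4, h3]
  simp [EuclideanSpace.inner_single_right, eq_comm]
  ring

theorem exists_fieldKernel (hd : 0 < d) : Nonempty (FieldKernel d) := by
  classical
  have hζc : Continuous fun x : 𝔼 =>
      -(2 * (‖x‖ ^ 2) ^ (1 - (d : ℝ) / 2) * deriv cutoff (‖x‖ ^ 2)) := by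
    have hdc : Continuous (deriv cutoff) := contDiff_cutoff.continuous_deriv (by simp)
    have : Continuous fun t : ℝ => -(2 * t ^ (1 - (d : ℝ) / 2) * deriv cutoff t) := by
      rw [continuous_iff_continuousAt]
      intro t
      rcases lt_or_ge t (1 / 4) with h | h
      · have : (fun t : ℝ => -(2 * t ^ (1 - (d : ℝ) / 2) * deriv cutoff t)) =ᶠ[𝓝 t]
            fun _ => 0 := by
          filter_upwards [Iio_mem_nhds h] with s hs
          rw [deriv_cutoff_of_lt hs]; simp
        exact this.continuousAt
      · exact ((continuousAt_const.mul (Real.continuousAt_rpow_const _ _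
          (Or.inl (by linarith)))).mul hdc.continuousAt).neg
    exact this.comp (by fun_prop)
  have hζn : ∀ x : 𝔼, 0 ≤ -(2 * (‖x‖ ^ 2) ^ (1 - (d : ℝ) / 2) * deriv cutoff (‖x‖ ^ 2)) := by
    intro x
    have := deriv_cutoff_nonpos (‖x‖ ^ 2)
    have h2 : 0 ≤ (‖x‖ ^ 2) ^ (1 - (d : ℝ) / 2) := by positivity
    nlinarith
  have hζs : Function.support (fun x : 𝔼 =>
      -(2 * (‖x‖ ^ 2) ^ (1 - (d : ℝ) / 2) * deriv cutoff (‖x‖ ^ 2))) ⊆ closedBall 0 1 := by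
    intro x hx
    by_contra h
    simp only [mem_closedBall, dist_zero_right, not_le] at h
    apply hx
    simp only
    rw [deriv_cutoff_of_gt (by nlinarith)]; simp
  refine ⟨⟨fun k x => profile d (‖x‖ ^ 2) * x k,
    fun x => -(2 * (‖x‖ ^ 2) ^ (1 - (d : ℝ) / 2) * deriv cutoff (‖x‖ ^ 2)),
    fun k => ?_, fun k => ?_, hζc, hζn, hζs, ?_, ?_, ?_⟩⟩
  · exact (contDiff_profile.comp (contDiff_norm_sq ℝ)).mul
      (EuclideanSpace.proj k : 𝔼 →L[ℝ] ℝ).contDiff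
  · refine closure_minimal (fun x hx => ?_) isClosed_closedBall
    by_contra h
    simp only [mem_closedBall, dist_zero_right, not_le] at h
    apply hx
    simp only
    rw [profile_of_ge (by nlinarith)]; simp
  · obtain ⟨t, ht, hneg⟩ := exists_deriv_cutoff_neg
    refine hζc.integral_pos_of_hasCompactSupport_nonneg_nonzero
      (HasCompactSupport.intro (isCompact_closedBall 0 1) fun x hx => ?_) hζn
      (x := EuclideanSpace.single ⟨0, hd⟩ (√t)) ?_
    · by_contra h; exact hx (hζs h)
    · have e : ‖(EuclideanSpace.single ⟨0, hd⟩ (√t) : 𝔼)‖ ^ 2 = t := by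
        rw [PiLp.norm_single, Real.norm_eq_abs, sq_abs, Real.sq_sqrt ht.le]
      rw [e]
      have h2 : 0 < t ^ (1 - (d : ℝ) / 2) := by positivity
      nlinarith [mul_neg_of_pos_of_neg h2 hneg]
  · intro j k x
    rw [pderiv'_profile, pderiv'_profile]
    by_cases h : j = k
    · subst h; rfl
    · rw [if_neg h, if_neg (Ne.symm h)]; ring
  · intro x
    simp only [pderiv'_profile, if_true, mul_one]
    rw [Finset.sum_add_distrib]
    have e1 : ∑ k, 2 * deriv (profile d) (‖x‖ ^ 2) * x k * x k
        = 2 * ‖x‖ ^ 2 * deriv (profile d) (‖x‖ ^ 2) := by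
      have : ∑ k, 2 * deriv (profile d) (‖x‖ ^ 2) * x k * x k
          = 2 * deriv (profile d) (‖x‖ ^ 2) * ∑ k, x k ^ 2 := by
        rw [Finset.mul_sum]
        exact Finset.sum_congr rfl fun k _ => by ring
      rw [this, ← EuclideanSpace.real_norm_sq_eq]
      ring
    rw [e1, Finset.sum_const, Finset.card_univ, Fintype.card_fin, nsmul_eq_mul]
    have e2 : ‖(2 : ℝ) • x‖ ^ 2 = 4 * ‖x‖ ^ 2 := by
      rw [norm_smul, mul_pow]; norm_num
    rw [e2]
    rcases eq_or_ne x 0 with rfl | hx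
    · simp [deriv_cutoff_of_lt, profile_of_lt]
    · have hpos : 0 < ‖x‖ ^ 2 := by positivity
      rw [deriv_profile hpos, Real.mul_rpow (by norm_num) hpos.le]
      have e3 : (4 : ℝ) ^ (1 - (d : ℝ) / 2) * 2 ^ d = 4 := by
        rw [show (4 : ℝ) = 2 ^ (2 : ℝ) by norm_num, ← Real.rpow_mul (by norm_num),
          ← Real.rpow_natCast, ← Real.rpow_add (by norm_num)]
        congr 1; ring
      linear_combination (2 * (‖x‖ ^ 2) ^ (1 - (d : ℝ) / 2) * deriv cutoff (4 * ‖x‖ ^ 2)) * e3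

section Calculus

variable {f g : EuclideanSpace ℝ (Fin d) → ℝ}

theorem contDiff_pderiv' {n : ℕ} (hf : ContDiff ℝ (n + 1) f) (j : Fin d) :
    ContDiff ℝ n (pderiv' j f) :=
  (hf.fderiv_right le_rfl).clm_apply contDiff_const

theorem tsupport_pderiv'_subset (j : Fin d) : tsupport (pderiv' j f) ⊆ tsupport f :=
  tsupport_fderiv_apply_subset ℝ _

theorem hasCompactSupport_pderiv' (hf : HasCompactSupport f) (j : Fin d) :
    HasCompactSupport (pderiv' j f) :=
  hf.fderiv_apply ℝ _

theorem pderiv'_comm (hf : ContDiff ℝ 2 f) (a b : Fin d) (x : 𝔼) :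
    pderiv' a (pderiv' b f) x = pderiv' b (pderiv' a f) x := by
  have hd : DifferentiableAt ℝ (fderiv ℝ f) x :=
    ((hf.fderiv_right (m := 1) le_rfl).differentiable (by simp)) x
  have key : ∀ i j : Fin d, pderiv' i (pderiv' j f) x
      = fderiv ℝ (fderiv ℝ f) x (EuclideanSpace.single i 1) (EuclideanSpace.single j 1) := by
    intro i j
    have := (hd.hasFDerivAt.clm_apply
      (hasFDerivAt_const (EuclideanSpace.single j (1 : ℝ)) x)).fderiv
    unfold pderiv'
    rw [this]; simp
  rw [key, key]
  exact (hf.contDiffAt.isSymmSndFDerivAt (by simp)) _ _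

theorem integral_mul_pderiv' (hf : ContDiff ℝ 1 f) (hg : ContDiff ℝ 1 g)
    (hfc : HasCompactSupport f) (a : Fin d) :
    ∫ x, f x * pderiv' a g x = -∫ x, pderiv' a f x * g x := by
  have h1 : Continuous (pderiv' a f) := (contDiff_pderiv' (n := 0) (by simpa using hf) a).continuous
  have h2 : Continuous (pderiv' a g) := (contDiff_pderiv' (n := 0) (by simpa using hg) a).continuous
  refine integral_mul_fderiv_eq_neg_fderiv_mul_of_integrable ?_ ?_ ?_
    (fun x _ => hf.differentiable (by simp) x) (fun x _ => hg.differentiable (by simp) x)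
  · exact (h1.mul hg.continuous).integrable_of_hasCompactSupport
      (hasCompactSupport_pderiv' hfc a).mul_right
  · exact (hf.continuous.mul h2).integrable_of_hasCompactSupport hfc.mul_right
  · exact (hf.continuous.mul hg.continuous).integrable_of_hasCompactSupport hfc.mul_right

theorem integral_pderiv'_mul_pderiv'_swap (hf : ContDiff ℝ 1 f) (hg : ContDiff ℝ 2 g)
    (hfc : HasCompactSupport f) (a b : Fin d) :
    ∫ x, pderiv' a f x * pderiv' b g x = ∫ x, pderiv' b f x * pderiv' a g x := by
  have h1 := integral_mul_pderiv' hf (contDiff_pderiv' (n := 1)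
    (hg.of_le (by rw [Nat.cast_one, one_add_one_eq_two])) b) hfc a
  have h2 := integral_mul_pderiv' hf (contDiff_pderiv' (n := 1)
    (hg.of_le (by rw [Nat.cast_one, one_add_one_eq_two])) a) hfc b
  simp_rw [pderiv'_comm hg a b] at h1
  linarith

/-- The `L²` norm of the gradient of a curl-free field is that of its divergence. -/
theorem integral_sq_pderiv'_le {U : Fin d → EuclideanSpace ℝ (Fin d) → ℝ}
    (hU : ∀ k, ContDiff ℝ 2 (U k)) (hc : ∀ k, HasCompactSupport (U k))
    (hs : ∀ j k x, pderiv' j (U k) x = pderiv' k (U j) x) (j k : Fin d) :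
    ∫ x, pderiv' j (U k) x ^ 2 ≤ ∫ x, (∑ k, pderiv' k (U k) x) ^ 2 := by
  have hU1 : ∀ k, ContDiff ℝ 1 (U k) := fun k => (hU k).of_le (by norm_num)
  have hcont : ∀ j k, Continuous (pderiv' j (U k)) := fun j k =>
    (contDiff_pderiv' (n := 0) (by simpa using hU1 k) j).continuous
  have hintg : ∀ a b a' b', Integrable fun x => pderiv' a (U b) x * pderiv' a' (U b') x :=
    fun a b a' b' => ((hcont a b).mul (hcont a' b')).integrable_of_hasCompactSupport
      (hasCompactSupport_pderiv' (hc b) a).mul_right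
  have e : ∫ x, (∑ k, pderiv' k (U k) x) ^ 2 = ∑ a, ∑ b, ∫ x, pderiv' a (U b) x ^ 2 := by
    simp_rw [sq, Finset.sum_mul_sum]
    rw [integral_finsetSum _ fun a _ => integrable_finsetSum _ fun b _ => hintg _ _ _ _]
    refine Finset.sum_congr rfl fun a _ => ?_
    rw [integral_finsetSum _ fun b _ => hintg _ _ _ _]
    refine Finset.sum_congr rfl fun b _ => ?_
    rw [← integral_pderiv'_mul_pderiv'_swap (hU1 a) (hU b) (hc a) b a]
    simp_rw [hs b a]
  rw [e]
  have hn : ∀ a b, 0 ≤ ∫ x, pderiv' a (U b) x ^ 2 := fun a b => integral_nonneg fun x => sq_nonneg _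
  exact (Finset.single_le_sum (f := fun b => ∫ x, pderiv' j (U b) x ^ 2) (fun b _ => hn j b)
    (Finset.mem_univ k)).trans (Finset.single_le_sum
      (f := fun a => ∑ b, ∫ x, pderiv' a (U b) x ^ 2)
      (fun a _ => Finset.sum_nonneg fun b _ => hn a b) (Finset.mem_univ j))

open scoped Convolution in
theorem contDiff_conv {n : ℕ} (hg : LocallyIntegrable g) (hf : ContDiff ℝ n f)
    (hfc : HasCompactSupport f) : ContDiff ℝ n fun y => ∫ x, f (y - x) * g x := by
  have := hfc.contDiff_convolution_right (n := (n : ℕ∞)) (ContinuousLinearMap.mul ℝ ℝ) hg hf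
  convert! this using 2 with y
  simp only [convolution_def, ContinuousLinearMap.mul_apply', mul_comm]

open scoped Convolution in
theorem pderiv'_conv (hg : LocallyIntegrable g) (hf : ContDiff ℝ 1 f)
    (hfc : HasCompactSupport f) (j : Fin d) (y : 𝔼) :
    pderiv' j (fun y => ∫ x, f (y - x) * g x) y = ∫ x, pderiv' j f (y - x) * g x := by
  have h := (hfc.hasFDerivAt_convolution_right (ContinuousLinearMap.mul ℝ ℝ) hg hf y).fderiv
  have e : (fun y => ∫ x, f (y - x) * g x) = g ⋆[ContinuousLinearMap.mul ℝ ℝ] f := by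
    ext y
    simp only [convolution_def, ContinuousLinearMap.mul_apply', mul_comm]
  rw [e]
  unfold pderiv'
  rw [h, convolution_precompR_apply _ hg (hfc.fderiv ℝ) (hf.continuous_fderiv (by simp))]
  simp only [convolution_def, ContinuousLinearMap.mul_apply', mul_comm]

theorem hasCompactSupport_conv (hgc : HasCompactSupport g)
    (hfc : HasCompactSupport f) : HasCompactSupport fun y => ∫ x, f (y - x) * g x := by
  have := hgc.convolution (ContinuousLinearMap.mul ℝ ℝ) (μ := volume) hfc
  convert! this using 2 with y
  simp only [convolution_def, ContinuousLinearMap.mul_apply', mul_comm]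

end Calculus

namespace FieldKernel

variable (K : FieldKernel d)

/-- The truncation at scale `2 ^ (-n)` of the homogeneous field of degree `1 - d` generated
by the field kernel. -/
noncomputable def field (n : ℕ) (k : Fin d) (x : EuclideanSpace ℝ (Fin d)) : ℝ :=
  ∑ i ∈ Finset.range n, ((2 : ℝ) ^ i) ^ d * ((2 : ℝ) ^ i)⁻¹ * K.V k ((2 : ℝ) ^ i • x)

theorem hasCompactSupport_V (k : Fin d) : HasCompactSupport (K.V k) :=
  (isCompact_closedBall 0 1).of_isClosed_subset (isClosed_tsupport _) (K.tsupport_subset k)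

theorem V_eq_zero {k : Fin d} {x : 𝔼} (hx : 1 < ‖x‖) : K.V k x = 0 := by
  by_contra h
  have := K.tsupport_subset k (subset_tsupport _ h)
  rw [mem_closedBall, dist_zero_right] at this
  linarith

theorem pderiv'_V_eq_zero {j k : Fin d} {x : 𝔼} (hx : 1 < ‖x‖) : pderiv' j (K.V k) x = 0 := by
  by_contra h
  have := K.tsupport_subset k (tsupport_pderiv'_subset j (subset_tsupport _ h))
  rw [mem_closedBall, dist_zero_right] at this
  linarith

theorem contDiff_field (n : ℕ) (k : Fin d) : ContDiff ℝ ∞ (K.field n k) :=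
  ContDiff.sum fun _ _ => contDiff_const.mul ((K.smooth k).comp (contDiff_const_smul _))

theorem one_le_two_pow_real (i : ℕ) : (1 : ℝ) ≤ 2 ^ i := one_le_pow₀ (by norm_num)

theorem tsupport_field (n : ℕ) (k : Fin d) : tsupport (K.field n k) ⊆ closedBall 0 1 := by
  refine closure_minimal (fun x hx => ?_) isClosed_closedBall
  by_contra h
  simp only [mem_closedBall, dist_zero_right, not_le] at h
  refine hx (Finset.sum_eq_zero fun i _ => ?_)
  rw [K.V_eq_zero, mul_zero]
  rw [norm_smul, Real.norm_of_nonneg (by positivity)]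
  nlinarith [one_le_two_pow_real i]

theorem hasCompactSupport_field (n : ℕ) (k : Fin d) : HasCompactSupport (K.field n k) :=
  (isCompact_closedBall 0 1).of_isClosed_subset (isClosed_tsupport _) (K.tsupport_field n k)

theorem pderiv'_field (n : ℕ) (j k : Fin d) (x : 𝔼) :
    pderiv' j (K.field n k) x
      = ∑ i ∈ Finset.range n, ((2 : ℝ) ^ i) ^ d * pderiv' j (K.V k) ((2 : ℝ) ^ i • x) := by
  have h (i : ℕ) : HasFDerivAt
      (fun y => ((2 : ℝ) ^ i) ^ d * ((2 : ℝ) ^ i)⁻¹ * K.V k ((2 : ℝ) ^ i • y))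
      ((((2 : ℝ) ^ i) ^ d * ((2 : ℝ) ^ i)⁻¹) • ((fderiv ℝ (K.V k) ((2 : ℝ) ^ i • x)).comp
        ((2 : ℝ) ^ i • ContinuousLinearMap.id ℝ 𝔼))) x :=
    (((((K.smooth k).differentiable (by simp)) ((2 : ℝ) ^ i • x)).hasFDerivAt).comp x
      ((hasFDerivAt_id x).const_smul ((2 : ℝ) ^ i))).const_mul _
  have := (HasFDerivAt.fun_sum (u := Finset.range n) fun i _ => h i).fderiv
  unfold pderiv' field
  rw [this]
  simp only [sum_apply, smul_apply,
    ContinuousLinearMap.comp_apply, ContinuousLinearMap.id_apply, map_smul, smul_eq_mul]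
  refine Finset.sum_congr rfl fun i _ => ?_
  have : ((2 : ℝ) ^ i) ≠ 0 := by positivity
  field_simp

theorem field_symm (n : ℕ) (j k : Fin d) (x : 𝔼) :
    pderiv' j (K.field n k) x = pderiv' k (K.field n j) x := by
  simp only [pderiv'_field, K.symm j k]

theorem div_field (n : ℕ) (x : 𝔼) :
    ∑ k, pderiv' k (K.field n k) x
      = ((2 : ℝ) ^ n) ^ d * K.ζ ((2 : ℝ) ^ n • x) - K.ζ x := by
  simp only [pderiv'_field]
  rw [Finset.sum_comm]
  have : ∀ i ∈ Finset.range n, ∑ k, ((2 : ℝ) ^ i) ^ d * pderiv' k (K.V k) ((2 : ℝ) ^ i • x)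
      = ((2 : ℝ) ^ (i + 1)) ^ d * K.ζ ((2 : ℝ) ^ (i + 1) • x)
        - ((2 : ℝ) ^ i) ^ d * K.ζ ((2 : ℝ) ^ i • x) := by
    intro i _
    rw [← Finset.mul_sum, K.div, smul_smul, pow_succ', mul_pow]
    ring
  rw [Finset.sum_congr rfl this,
    Finset.sum_range_sub (fun i => ((2 : ℝ) ^ i) ^ d * K.ζ ((2 : ℝ) ^ i • x))]
  simp

end FieldKernel

theorem ofReal_mul_lintegral_comp_smul {f : 𝔼 → ℝ≥0∞} (hf : Measurable f) {r : ℝ} (hr : 0 < r) :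
    ENNReal.ofReal (r ^ d) * ∫⁻ x, f (r • x) = ∫⁻ x, f x := by
  have h := Measure.map_addHaar_smul (volume : Measure 𝔼) hr.ne'
  rw [finrank_euclideanSpace_fin, abs_of_pos (by positivity)] at h
  rw [← lintegral_map hf (measurable_const_smul r), h, lintegral_smul_measure, smul_eq_mul,
    ← mul_assoc, ← ENNReal.ofReal_mul (by positivity), mul_inv_cancel₀ (by positivity)]
  simp

/-- An `L¹` bound for integral operators, by Tonelli's theorem. -/
theorem lintegral_enorm_integral_le {κ : 𝔼 → 𝔼 → ℝ} (hκ : Continuous (Function.uncurry κ))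
    {ν α : Measure 𝔼} [SFinite ν] [SFinite α] {s : 𝔼 → ℝ} (hs : AEStronglyMeasurable s ν)
    {H : ℝ≥0∞} (hH : ∀ᵐ x ∂ν, ∫⁻ y, ‖κ y x‖ₑ ∂α ≤ H) :
    ∫⁻ y, ‖∫ x, κ y x * s x ∂ν‖ₑ ∂α ≤ H * ∫⁻ x, ‖s x‖ₑ ∂ν := by
  calc ∫⁻ y, ‖∫ x, κ y x * s x ∂ν‖ₑ ∂α
      ≤ ∫⁻ y, ∫⁻ x, ‖κ y x‖ₑ * ‖s x‖ₑ ∂ν ∂α := by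
        refine lintegral_mono fun y => (enorm_integral_le_lintegral_enorm _).trans_eq ?_
        simp_rw [enorm_mul]
    _ = ∫⁻ x, ∫⁻ y, ‖κ y x‖ₑ * ‖s x‖ₑ ∂α ∂ν := by
        refine lintegral_lintegral_swap ?_
        show AEMeasurable (fun p : 𝔼 × 𝔼 => ‖κ p.1 p.2‖ₑ * ‖s p.2‖ₑ) (α.prod ν)
        refine AEMeasurable.mul (f := fun p : 𝔼 × 𝔼 => ‖κ p.1 p.2‖ₑ)
          (g := fun p : 𝔼 × 𝔼 => ‖s p.2‖ₑ) ?_ ?_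
        · exact hκ.measurable.enorm.aemeasurable
        · exact (hs.enorm).comp_quasiMeasurePreserving Measure.quasiMeasurePreserving_snd
    _ ≤ ∫⁻ x, H * ‖s x‖ₑ ∂ν := by
        refine lintegral_mono_ae ?_
        filter_upwards [hH] with x hx
        have hm : Measurable fun y => ‖κ y x‖ₑ :=
          (hκ.comp (by fun_prop : Continuous fun y : 𝔼 => (y, x))).measurable.enorm
        rw [lintegral_mul_const _ hm]
        gcongr
    _ = H * ∫⁻ x, ‖s x‖ₑ ∂ν := lintegral_const_mul'' _ hs.enorm

/-- A geometric sum truncated at its first term larger than one. -/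
theorem sum_truncated_geom_le (h : ℝ) (hh : 0 ≤ h) (n : ℕ) :
    ∑ i ∈ Finset.range n, (if (2 : ℝ) ^ i * h ≤ 1 then 2 ^ i * h else 0) ≤ 2 := by
  have key : ∀ n : ℕ, ∑ i ∈ Finset.range n, (if (2 : ℝ) ^ i * h ≤ 1 then 2 ^ i * h else 0)
      ≤ 2 ^ n * h := by
    intro n
    induction n with
    | zero => simpa
    | succ n ih =>
      rw [Finset.sum_range_succ, pow_succ]
      have : 0 ≤ (2 : ℝ) ^ n * h := by positivity
      split_ifs <;> linarith
  induction n with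
  | zero => simp
  | succ n ih =>
    by_cases hn : (2 : ℝ) ^ n * h ≤ 1
    · refine (key (n + 1)).trans ?_
      rw [pow_succ]; linarith
    · rw [Finset.sum_range_succ, if_neg hn]; linarith

theorem lintegral_dilate_sub_le {κ : 𝔼 → ℝ} {L : NNReal} (hL : LipschitzWith L κ)
    (h0 : ∀ x, 1 < ‖x‖ → κ x = 0) {r h : ℝ} (hr : 0 < r) {u : 𝔼}
    (hu : ‖u‖ ≤ h) {A : Set 𝔼} (hA : 1 < r * h → ∀ z ∈ A, 2 * h ≤ ‖z‖) :
    ∫⁻ z in A, ‖r ^ d * κ (r • (z - u)) - r ^ d * κ (r • z)‖ₑ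
      ≤ ENNReal.ofReal (if r * h ≤ 1 then r * h else 0) * (L * volume (closedBall (0 : 𝔼) 2)) := by
  have hκ : Continuous κ := hL.continuous
  have hh : 0 ≤ h := (norm_nonneg u).trans hu
  split_ifs with hrh
  · calc ∫⁻ z in A, ‖r ^ d * κ (r • (z - u)) - r ^ d * κ (r • z)‖ₑ
        ≤ ∫⁻ z, ‖r ^ d * κ (r • (z - u)) - r ^ d * κ (r • z)‖ₑ :=
          setLIntegral_le_lintegral _ _
      _ = ∫⁻ z, ‖κ (z - r • u) - κ z‖ₑ := by
          rw [← ofReal_mul_lintegral_comp_smul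
            (f := fun z => ‖κ (z - r • u) - κ z‖ₑ) (by fun_prop) hr,
            ← lintegral_const_mul _ (by fun_prop)]
          refine lintegral_congr fun z => ?_
          rw [← mul_sub, enorm_mul, Real.enorm_of_nonneg (by positivity), smul_sub]
      _ ≤ ∫⁻ z, (closedBall (0 : 𝔼) 2).indicator (fun _ => ENNReal.ofReal (r * h) * L) z := by
          refine lintegral_mono fun z => ?_
          have hru : ‖r • u‖ ≤ r * h := by
            rw [norm_smul, Real.norm_of_nonneg hr.le]; gcongr
          by_cases hz : z ∈ closedBall (0 : 𝔼) 2
          · rw [indicator_of_mem hz, mul_comm, ← edist_eq_enorm_sub]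
            refine (hL _ _).trans ?_
            gcongr
            rw [edist_eq_enorm_sub, ← ofReal_norm]
            refine ENNReal.ofReal_le_ofReal ?_
            rwa [sub_sub_cancel_left, norm_neg]
          · rw [mem_closedBall, dist_zero_right, not_le] at hz
            have := norm_sub_norm_le z (r • u)
            rw [h0 z (by linarith), h0 (z - r • u) (by linarith)]
            simp
      _ = _ := by
          rw [lintegral_indicator measurableSet_closedBall, lintegral_const,
            Measure.restrict_apply_univ, mul_assoc]
  · rw [not_le] at hrh
    have : ∀ z ∈ A, ‖r ^ d * κ (r • (z - u)) - r ^ d * κ (r • z)‖ₑ = 0 := by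
      intro z hz
      have h1 := hA hrh z hz
      have h2 := norm_sub_norm_le z u
      rw [h0 (r • (z - u)), h0 (r • z)]
      · simp
      · rw [norm_smul, Real.norm_of_nonneg hr.le]; nlinarith
      · rw [norm_smul, Real.norm_of_nonneg hr.le]; nlinarith
    have h3 : ∫⁻ z in A, ‖r ^ d * κ (r • (z - u)) - r ^ d * κ (r • z)‖ₑ ≤ ∫⁻ z in A, 0 := by
      refine setLIntegral_mono measurable_const fun z hz => (this z hz).le
    simpa using h3

namespace FieldKernel

variable (K : FieldKernel d)

theorem lintegral_field_le (n : ℕ) (k : Fin d) :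
    ∫⁻ x, ‖K.field n k x‖ₑ ≤ 2 * ∫⁻ x, ‖K.V k x‖ₑ := by
  have hV : Continuous (K.V k) := (K.smooth k).continuous
  unfold field
  generalize K.V k = v at hV ⊢
  have hv (r : ℝ) : Measurable fun x => v (r • x) :=
    (hV.comp (continuous_const_smul r)).measurable
  calc ∫⁻ x, ‖∑ i ∈ Finset.range n, ((2 : ℝ) ^ i) ^ d * ((2 : ℝ) ^ i)⁻¹ * v ((2 : ℝ) ^ i • x)‖ₑ
      ≤ ∫⁻ x, ∑ i ∈ Finset.range n,
          ‖((2 : ℝ) ^ i) ^ d * ((2 : ℝ) ^ i)⁻¹ * v ((2 : ℝ) ^ i • x)‖ₑ :=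
        lintegral_mono fun x => enorm_sum_le _ _
    _ = ∑ i ∈ Finset.range n, ENNReal.ofReal ((1 / 2 : ℝ) ^ i) * ∫⁻ x, ‖v x‖ₑ := by
        rw [lintegral_finsetSum _ fun i _ => ((hv _).const_mul _).enorm]
        refine Finset.sum_congr rfl fun i _ => ?_
        rw [← ofReal_mul_lintegral_comp_smul (f := fun x => ‖v x‖ₑ) hV.measurable.enorm
          (r := (2 : ℝ) ^ i) (by positivity), ← mul_assoc, ← ENNReal.ofReal_mul (by positivity),
          ← lintegral_const_mul _ (hv _).enorm]
        refine lintegral_congr fun x => ?_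
        rw [enorm_mul, Real.enorm_of_nonneg (by positivity), mul_comm (((2 : ℝ) ^ i) ^ d),
          ← inv_pow, one_div]
    _ ≤ 2 * ∫⁻ x, ‖v x‖ₑ := by
        rw [← Finset.sum_mul, ← ENNReal.ofReal_sum_of_nonneg fun i _ => by positivity]
        gcongr
        rw [show (2 : ℝ≥0∞) = ENNReal.ofReal 2 by simp]
        refine ENNReal.ofReal_le_ofReal ?_
        rw [geom_sum_eq (by norm_num)]
        have : (0 : ℝ) < (1 / 2) ^ n := by positivity
        rw [div_le_iff_of_neg (by norm_num)]
        linarith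

theorem exists_lipschitz : ∃ L : NNReal, ∀ j k, LipschitzWith L (pderiv' j (K.V k)) := by
  have h : ∀ p : Fin d × Fin d, ∃ L : NNReal, LipschitzWith L (pderiv' p.1 (K.V p.2)) := fun p =>
    ContDiff.lipschitzWith_of_hasCompactSupport (n := 1) (𝕂 := ℝ)
      (hasCompactSupport_pderiv' (K.hasCompactSupport_V p.2) p.1)
      (by simpa using contDiff_pderiv' (n := 1) ((K.smooth p.2).of_le (by norm_cast)) p.1)
      (by simp)
  choose L hL using h
  exact ⟨∑ p, L p, fun j k => (hL (j, k)).weaken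
    (Finset.single_le_sum (f := L) (fun _ _ => zero_le) (Finset.mem_univ (j, k)))⟩

/-- The Lipschitz constant of the derivatives of the field. -/
noncomputable def lip : NNReal := K.exists_lipschitz.choose

/-- The constant in Hörmander's condition. -/
noncomputable def hormander : ℝ≥0∞ := 2 * (K.lip * volume (closedBall (0 : 𝔼) 2))

theorem hormander_ne_top : K.hormander ≠ (⊤ : ℝ≥0∞) :=
  ENNReal.mul_ne_top ENNReal.ofNat_ne_top (ENNReal.mul_ne_top ENNReal.coe_ne_top
    (isCompact_closedBall _ _).measure_lt_top.ne)

theorem continuous_pderiv'_V (j k : Fin d) : Continuous (pderiv' j (K.V k)) :=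
  (contDiff_pderiv' (n := 0) ((K.smooth k).of_le (by norm_cast)) j).continuous

theorem continuous_pderiv'_field (n : ℕ) (j k : Fin d) : Continuous (pderiv' j (K.field n k)) :=
  (contDiff_pderiv' (n := 0) ((K.contDiff_field n k).of_le (by norm_cast)) j).continuous

/-- Hörmander's condition, uniformly in the truncation. -/
theorem lintegral_sub_le_hormander (n : ℕ) (j k : Fin d) {h : ℝ} {u : 𝔼} (hu : ‖u‖ ≤ h)
    {A : Set 𝔼} (hA : 1 < 2 ^ n * h → ∀ z ∈ A, 2 * h ≤ ‖z‖) :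
    ∫⁻ z in A, ‖pderiv' j (K.field n k) (z - u) - pderiv' j (K.field n k) z‖ₑ ≤ K.hormander := by
  have hh : 0 ≤ h := (norm_nonneg u).trans hu
  have hc := K.continuous_pderiv'_V j k
  simp only [pderiv'_field, ← Finset.sum_sub_distrib]
  calc _ ≤ ∫⁻ z in A, ∑ i ∈ Finset.range n, ‖((2 : ℝ) ^ i) ^ d *
            pderiv' j (K.V k) ((2 : ℝ) ^ i • (z - u))
            - ((2 : ℝ) ^ i) ^ d * pderiv' j (K.V k) ((2 : ℝ) ^ i • z)‖ₑ :=
        lintegral_mono fun z => enorm_sum_le _ _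
    _ = ∑ i ∈ Finset.range n, ∫⁻ z in A, ‖((2 : ℝ) ^ i) ^ d *
            pderiv' j (K.V k) ((2 : ℝ) ^ i • (z - u))
            - ((2 : ℝ) ^ i) ^ d * pderiv' j (K.V k) ((2 : ℝ) ^ i • z)‖ₑ :=
        lintegral_finsetSum _ fun i _ => by fun_prop
    _ ≤ ∑ i ∈ Finset.range n, ENNReal.ofReal (if (2 : ℝ) ^ i * h ≤ 1 then 2 ^ i * h else 0)
          * (K.lip * volume (closedBall (0 : 𝔼) 2)) := by
        refine Finset.sum_le_sum fun i hi => ?_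
        refine lintegral_dilate_sub_le (K.exists_lipschitz.choose_spec j k)
          (fun x hx => K.pderiv'_V_eq_zero hx) (by positivity) hu fun h1 => hA (h1.trans_le ?_)
        gcongr
        · norm_num
        · exact (Finset.mem_range.1 hi).le
    _ ≤ K.hormander := by
        rw [← Finset.sum_mul, hormander, ← ENNReal.ofReal_sum_of_nonneg
          (fun i _ => by split_ifs <;> positivity)]
        gcongr
        rw [show (2 : ℝ≥0∞) = ENNReal.ofReal 2 by simp]
        exact ENNReal.ofReal_le_ofReal (sum_truncated_geom_le h hh n)

/-- The bump at scale `2 ^ (-n)`. -/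
noncomputable def bump (n : ℕ) (x : EuclideanSpace ℝ (Fin d)) : ℝ :=
  ((2 : ℝ) ^ n) ^ d * K.ζ ((2 : ℝ) ^ n • x)

theorem continuous_bump (n : ℕ) : Continuous (K.bump n) :=
  continuous_const.mul (K.ζ_cont.comp (continuous_const_smul _))

theorem bump_nonneg (n : ℕ) (x : 𝔼) : 0 ≤ K.bump n x :=
  mul_nonneg (by positivity) (K.ζ_nonneg _)

theorem hasCompactSupport_ζ : HasCompactSupport K.ζ :=
  HasCompactSupport.of_support_subset_isCompact (isCompact_closedBall 0 1) K.ζ_support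

theorem integrable_ζ : Integrable K.ζ :=
  K.ζ_cont.integrable_of_hasCompactSupport K.hasCompactSupport_ζ

theorem bump_eq_zero {n : ℕ} {x : 𝔼} (hx : 1 < 2 ^ n * ‖x‖) : K.bump n x = 0 := by
  by_contra h
  have h1 : K.ζ ((2 : ℝ) ^ n • x) ≠ 0 := fun h0 => h (by rw [bump, h0, mul_zero])
  have := K.ζ_support h1
  rw [mem_closedBall, dist_zero_right, norm_smul, Real.norm_of_nonneg (by positivity)] at this
  linarith

theorem hasCompactSupport_bump (n : ℕ) : HasCompactSupport (K.bump n) := by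
  refine HasCompactSupport.intro (isCompact_closedBall 0 1) fun x hx => ?_
  rw [mem_closedBall, dist_zero_right, not_le] at hx
  refine K.bump_eq_zero ?_
  nlinarith [one_le_two_pow_real n]

theorem integrable_bump (n : ℕ) : Integrable (K.bump n) :=
  (K.continuous_bump n).integrable_of_hasCompactSupport (K.hasCompactSupport_bump n)

theorem lintegral_bump (n : ℕ) : ∫⁻ x, ‖K.bump n x‖ₑ = ENNReal.ofReal (∫ x, K.ζ x) := by
  have hc := K.ζ_cont
  rw [ofReal_integral_eq_lintegral_ofReal K.integrable_ζ (ae_of_all _ K.ζ_nonneg),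
    ← ofReal_mul_lintegral_comp_smul (f := fun x => ENNReal.ofReal (K.ζ x)) (by fun_prop)
      (r := (2 : ℝ) ^ n) (by positivity), ← lintegral_const_mul _ (by fun_prop)]
  refine lintegral_congr fun x => ?_
  rw [Real.enorm_of_nonneg (K.bump_nonneg n x), bump, ENNReal.ofReal_mul (by positivity)]

theorem integral_bump (n : ℕ) : ∫ x, K.bump n x = ∫ x, K.ζ x := by
  have h := K.lintegral_bump n
  rw [integral_eq_lintegral_of_nonneg_ae (ae_of_all _ (K.bump_nonneg n))
    (K.continuous_bump n).aestronglyMeasurable]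
  simp_rw [← fun x => Real.enorm_of_nonneg (K.bump_nonneg n x)]
  rw [h, ENNReal.toReal_ofReal K.ζ_pos.le]

theorem bump_zero : K.bump 0 = K.ζ := by
  ext x; simp [bump]

theorem div_field_eq (n : ℕ) (x : 𝔼) :
    ∑ k, pderiv' k (K.field n k) x = K.bump n x - K.bump 0 x := by
  rw [div_field, bump_zero, bump]


end FieldKernel

/-- Young's inequality `‖b * g‖₂² ≤ ‖b‖₁² ‖g‖_∞ ‖g‖₁`. -/
theorem integral_sq_conv_le_of_bound {b g : 𝔼 → ℝ} (hb : Continuous b) (hbc : HasCompactSupport b)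
    {B : ℝ} (hB : ∫ x, |b x| ≤ B) (hgi : Integrable g)
    (hgc : HasCompactSupport g) {M : ℝ} (hM : ∀ x, |g x| ≤ M) :
    ∫ y, (∫ x, b (y - x) * g x) ^ 2 ≤ B ^ 2 * M * ∫ x, |g x| := by
  have hM0 : 0 ≤ M := (abs_nonneg _).trans (hM 0)
  have hB0 : 0 ≤ B := (integral_nonneg fun _ => abs_nonneg _).trans hB
  have hbi : Integrable b := hb.integrable_of_hasCompactSupport hbc
  have hsup : ∀ y, |∫ x, b (y - x) * g x| ≤ B * M := by
    intro y
    calc |∫ x, b (y - x) * g x| ≤ ∫ x, |b (y - x)| * M := by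
          rw [← Real.norm_eq_abs]
          refine norm_integral_le_of_norm_le ((hbi.comp_sub_left y).abs.mul_const M)
            (ae_of_all _ fun x => ?_)
          rw [norm_mul, Real.norm_eq_abs, Real.norm_eq_abs]
          exact mul_le_mul_of_nonneg_left (hM x) (abs_nonneg _)
      _ = (∫ x, |b x|) * M := by
          rw [integral_mul_const, integral_sub_left_eq_self (fun x => |b x|) volume y]
      _ ≤ B * M := by gcongr
  have hDc : Continuous fun y => ∫ x, b (y - x) * g x :=
    (contDiff_zero (𝕜 := ℝ)).1 (contDiff_conv (n := 0) hgi.locallyIntegrable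
      (contDiff_zero.2 hb) hbc)
  have hDs : HasCompactSupport fun y => ∫ x, b (y - x) * g x := hasCompactSupport_conv hgc hbc
  have hDi := hDc.integrable_of_hasCompactSupport (μ := volume) hDs
  have hL1 : ∫ y, |∫ x, b (y - x) * g x| ≤ B * ∫ x, |g x| := by
    have hy := lintegral_enorm_integral_le (κ := fun y x => b (y - x))
      (ν := volume) (α := volume) (s := g) (H := ENNReal.ofReal B)
      (hb.comp (by fun_prop)) hgi.aestronglyMeasurable (ae_of_all _ fun x => by
        rw [lintegral_sub_right_eq_self (fun y => ‖b y‖ₑ) x,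
          ← ofReal_integral_norm_eq_lintegral_enorm hbi]
        exact ENNReal.ofReal_le_ofReal hB)
    rw [← ofReal_integral_norm_eq_lintegral_enorm hgi, ← ofReal_integral_norm_eq_lintegral_enorm
      hDi, ← ENNReal.ofReal_mul hB0] at hy
    exact (ENNReal.ofReal_le_ofReal_iff
      (mul_nonneg hB0 (integral_nonneg fun _ => norm_nonneg _))).1 hy
  calc ∫ y, (∫ x, b (y - x) * g x) ^ 2
      ≤ ∫ y, B * M * |∫ x, b (y - x) * g x| := by
        refine integral_mono ?_ (hDi.abs.const_mul _) fun y => ?_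
        · refine (hDc.pow 2).integrable_of_hasCompactSupport ?_
          simp only [sq]
          exact hDs.mul_right
        · simp only
          rw [← sq_abs, sq]
          exact mul_le_mul_of_nonneg_right (hsup y) (abs_nonneg _)
    _ = B * M * ∫ y, |∫ x, b (y - x) * g x| := integral_const_mul _ _
    _ ≤ B * M * (B * ∫ x, |g x|) := by gcongr
    _ = _ := by ring

namespace FieldKernel

variable (K : FieldKernel d)

theorem integral_abs_bump_sub_le (n : ℕ) :
    ∫ x, |K.bump n x - K.bump 0 x| ≤ 2 * ∫ x, K.ζ x := by
  have hbi : Integrable fun x => K.bump n x - K.bump 0 x :=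
    (K.integrable_bump n).sub (K.integrable_bump 0)
  calc ∫ x, |K.bump n x - K.bump 0 x| ≤ ∫ x, (K.bump n x + K.bump 0 x) := by
        refine integral_mono hbi.abs ((K.integrable_bump n).add (K.integrable_bump 0)) fun x => ?_
        have h1 := K.bump_nonneg n x
        have h2 := K.bump_nonneg 0 x
        simp only
        rw [abs_le]; constructor <;> linarith
    _ = 2 * ∫ x, K.ζ x := by
        rw [integral_add (K.integrable_bump n) (K.integrable_bump 0), integral_bump,
          integral_bump]; ring

/-- The `L²` bound for the singular integral operators defined by the derivatives of the field. -/
theorem integral_sq_conv_le (n : ℕ) (j k : Fin d) {g : 𝔼 → ℝ} (hgi : Integrable g)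
    (hgc : HasCompactSupport g) {M : ℝ} (hM : ∀ x, |g x| ≤ M) :
    ∫ y, (∫ x, pderiv' j (K.field n k) (y - x) * g x) ^ 2
      ≤ (2 * ∫ x, K.ζ x) ^ 2 * M * ∫ x, |g x| := by
  have hl := hgi.locallyIntegrable
  have hsm : ∀ k, ContDiff ℝ 2 (K.field n k) := fun k =>
    (K.contDiff_field n k).of_le (by norm_cast)
  have hsm1 : ∀ k, ContDiff ℝ 1 (K.field n k) := fun k => (hsm k).of_le (by norm_num)
  have hcs := K.hasCompactSupport_field n
  have hUp : ∀ j k y, pderiv' j (fun y => ∫ x, K.field n k (y - x) * g x) y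
      = ∫ x, pderiv' j (K.field n k) (y - x) * g x := fun j k y =>
    pderiv'_conv hl (hsm1 k) (hcs k) j y
  have hB : ∀ y : 𝔼, ∀ k, Integrable fun x => pderiv' k (K.field n k) (y - x) * g x := by
    intro y k
    obtain ⟨C, hC⟩ := (hasCompactSupport_pderiv' (hcs k) k).exists_bound_of_continuous
      (K.continuous_pderiv'_field n k k)
    refine hgi.bdd_mul (c := C) ?_ (ae_of_all _ fun x => hC _)
    exact ((K.continuous_pderiv'_field n k k).comp (by fun_prop)).aestronglyMeasurable
  have h := integral_sq_pderiv'_le (U := fun k y => ∫ x, K.field n k (y - x) * g x)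
    (fun k => contDiff_conv (n := 2) hl (hsm k) (hcs k)) (fun k => hasCompactSupport_conv hgc (hcs k))
    (fun j k y => by simp only [hUp, K.field_symm n j k]) j k
  simp only [hUp] at h
  refine h.trans ?_
  have hD : ∀ y, ∑ k, ∫ x, pderiv' k (K.field n k) (y - x) * g x
      = ∫ x, (fun z => K.bump n z - K.bump 0 z) (y - x) * g x := by
    intro y
    rw [← integral_finsetSum _ fun k _ => hB y k]
    simp only [← Finset.sum_mul, K.div_field_eq]
  simp only [hD]
  exact integral_sq_conv_le_of_bound ((K.continuous_bump n).sub (K.continuous_bump 0))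
    ((K.hasCompactSupport_bump n).sub (K.hasCompactSupport_bump 0)) (K.integral_abs_bump_sub_le n)
    hgi hgc hM

end FieldKernel

/-- The half-open cube with corner `a` and side `ℓ`. -/
def cube (a : Fin d → ℝ) (ℓ : ℝ) : Set (EuclideanSpace ℝ (Fin d)) :=
  {x | ∀ i, a i ≤ x i ∧ x i < a i + ℓ}

theorem cube_eq_preimage (a : Fin d → ℝ) (ℓ : ℝ) :
    cube a ℓ = (WithLp.ofLp : 𝔼 → Fin d → ℝ) ⁻¹' Set.pi univ fun i => Ico (a i) (a i + ℓ) := by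
  ext x
  simp [cube]

theorem measurableSet_cube (a : Fin d → ℝ) (ℓ : ℝ) : MeasurableSet (cube a ℓ) := by
  rw [cube_eq_preimage]
  exact (MeasurableSet.univ_pi fun i => measurableSet_Ico).preimage
    (PiLp.continuous_ofLp 2 _).measurable

theorem volume_cube (a : Fin d → ℝ) {ℓ : ℝ} (hℓ : 0 ≤ ℓ) :
    volume (cube a ℓ) = ENNReal.ofReal (ℓ ^ d) := by
  rw [cube_eq_preimage, (PiLp.volume_preserving_ofLp (Fin d)).measure_preimage
    (MeasurableSet.univ_pi fun i => measurableSet_Ico).nullMeasurableSet, Real.volume_pi_Ico]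
  simp [ENNReal.ofReal_pow hℓ]

theorem norm_le_sum_abs (x : 𝔼) : ‖x‖ ≤ ∑ i, |x i| := by
  rw [EuclideanSpace.norm_eq]
  refine Real.sqrt_le_iff.2 ⟨Finset.sum_nonneg fun _ _ => abs_nonneg _, ?_⟩
  exact Finset.sum_sq_le_sq_sum_of_nonneg fun _ _ => abs_nonneg _

theorem norm_sub_corner_le {a : Fin d → ℝ} {ℓ : ℝ} {x : 𝔼} (hx : x ∈ cube a ℓ) :
    ‖x - WithLp.toLp 2 a‖ ≤ d * ℓ := by
  refine (norm_le_sum_abs _).trans ?_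
  calc _ ≤ ∑ _i : Fin d, ℓ := by
        refine Finset.sum_le_sum fun i _ => ?_
        have := hx i
        simp only [PiLp.sub_apply]
        rw [abs_of_nonneg (by linarith)]
        linarith
    _ = d * ℓ := by simp

theorem closedBall_subset_cube {r : ℝ} (hr : 0 < r) :
    closedBall (0 : 𝔼) r ⊆ cube (fun _ => -(2 * r)) (4 * r) := by
  intro x hx i
  rw [mem_closedBall, dist_zero_right] at hx
  have := (PiLp.norm_apply_le x i).trans hx
  rw [Real.norm_eq_abs, abs_le] at this
  constructor <;> linarith

/-- The corner of a child of a dyadic cube. -/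
noncomputable def childCorner (a : Fin d → ℝ) (ℓ : ℝ) (b : Fin d → Bool) : Fin d → ℝ :=
  fun i => a i + if b i then ℓ / 2 else 0

theorem mem_cube_child {a : Fin d → ℝ} {ℓ : ℝ} (hℓ : 0 < ℓ) {b : Fin d → Bool} {x : 𝔼} :
    x ∈ cube (childCorner a ℓ b) (ℓ / 2) ↔
      x ∈ cube a ℓ ∧ b = fun i => decide (a i + ℓ / 2 ≤ x i) := by
  simp only [cube, mem_ofPred_eq, funext_iff, ← forall_and]
  refine forall_congr' fun i => ?_
  cases hb : b i
  · simp only [childCorner, hb, Bool.false_eq_true, if_false, add_zero]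
    rw [eq_comm, decide_eq_false_iff_not, not_le]
    constructor
    · rintro ⟨h1, h2⟩; exact ⟨⟨h1, by linarith⟩, h2⟩
    · rintro ⟨⟨h1, _⟩, h2⟩; exact ⟨h1, h2⟩
  · simp only [childCorner, hb, if_true]
    rw [eq_comm, decide_eq_true_iff]
    constructor
    · rintro ⟨h1, h2⟩; exact ⟨⟨by linarith, by linarith⟩, h1⟩
    · rintro ⟨⟨_, h1⟩, h2⟩; exact ⟨h2, by linarith⟩

theorem indicator_cube_eq_sum {a : Fin d → ℝ} {ℓ : ℝ} (hℓ : 0 < ℓ) (x : 𝔼) :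
    (cube a ℓ).indicator (fun _ => (1 : ℝ)) x
      = ∑ b, (cube (childCorner a ℓ b) (ℓ / 2)).indicator (fun _ => (1 : ℝ)) x := by
  classical
  simp only [indicator_apply, mem_cube_child hℓ]
  by_cases hx : x ∈ cube a ℓ <;> simp [hx]

/-- A stopping-time decomposition of a cube into dyadic cubes which are either small or heavy. -/
theorem exists_dyadic_decomposition (m : Measure 𝔼) (N : ℕ) (a : Fin d → ℝ) {ℓ : ℝ} (hℓ : 0 < ℓ)
    (hm : m (cube a ℓ) ≤ ENNReal.ofReal ((2 * ℓ) ^ d)) :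
    ∃ (ι : Type) (_ : Fintype ι) (c : ι → Fin d → ℝ) (s : ι → ℝ), (∀ i, 0 < s i) ∧
      (∀ x, (cube a ℓ).indicator (fun _ => (1 : ℝ)) x
        = ∑ i, (cube (c i) (s i)).indicator (fun _ => (1 : ℝ)) x) ∧
      (∀ i, m (cube (c i) (s i)) ≤ ENNReal.ofReal ((2 * s i) ^ d)) ∧
      ∀ i, ENNReal.ofReal (s i ^ d) < m (cube (c i) (s i)) ∨ s i ≤ ℓ / 2 ^ N := by
  induction N generalizing a ℓ with
  | zero =>
    exact ⟨Unit, inferInstance, fun _ => a, fun _ => ℓ, fun _ => hℓ, by simp, fun _ => hm,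
      fun _ => Or.inr (by simp)⟩
  | succ N ih =>
    by_cases h : ENNReal.ofReal (ℓ ^ d) < m (cube a ℓ)
    · exact ⟨Unit, inferInstance, fun _ => a, fun _ => ℓ, fun _ => hℓ, by simp, fun _ => hm,
        fun _ => Or.inl h⟩
    · rw [not_lt] at h
      have hch : ∀ b, m (cube (childCorner a ℓ b) (ℓ / 2))
          ≤ ENNReal.ofReal ((2 * (ℓ / 2)) ^ d) := fun b => by
        rw [mul_div_cancel₀ _ two_ne_zero]
        exact (measure_mono fun x hx => ((mem_cube_child hℓ).1 hx).1).trans h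
      choose ι hι c s hs hid hms hor using fun b => ih (childCorner a ℓ b) (half_pos hℓ) (hch b)
      refine ⟨Σ b, ι b, inferInstance, fun p => c p.1 p.2, fun p => s p.1 p.2,
        fun p => hs _ _, fun x => ?_, fun p => hms _ _, fun p => ?_⟩
      · rw [indicator_cube_eq_sum hℓ, Fintype.sum_sigma]
        exact Finset.sum_congr rfl fun b _ => hid b x
      · refine (hor p.1 p.2).imp_right fun h => h.trans_eq ?_
        rw [pow_succ]
        field_simp

theorem integrable_comp_sub_mul {κ : 𝔼 → ℝ} (hκ : Continuous κ) (hc : HasCompactSupport κ)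
    {ν : Measure 𝔼} {s : 𝔼 → ℝ} (hs : Integrable s ν) (y : 𝔼) :
    Integrable (fun x => κ (y - x) * s x) ν := by
  obtain ⟨C, hC⟩ := hc.exists_bound_of_continuous hκ
  exact hs.bdd_mul (c := C) (hκ.comp (by fun_prop)).aestronglyMeasurable (ae_of_all _ fun x => hC _)

/-- Chebyshev's inequality in the form `|F| ≤ θ + F² / θ`. -/
theorem setLIntegral_enorm_le_of_sq {f : 𝔼 → ℝ} (hf : Continuous f) (hc : HasCompactSupport f)
    {θ b : ℝ} (hθ : 0 < θ) (hb : ∫ y, f y ^ 2 ≤ b) (A : Set 𝔼) :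
    ∫⁻ y in A, ‖f y‖ₑ ≤ ENNReal.ofReal θ * volume A + ENNReal.ofReal (b / θ) := by
  have hi : Integrable fun y => f y ^ 2 := by
    refine (hf.pow 2).integrable_of_hasCompactSupport ?_
    simp only [sq]
    exact hc.mul_right
  calc ∫⁻ y in A, ‖f y‖ₑ
      ≤ ∫⁻ y in A, (ENNReal.ofReal θ + ENNReal.ofReal (f y ^ 2 / θ)) := by
        refine lintegral_mono fun y => ?_
        rw [← ENNReal.ofReal_add hθ.le (by positivity), Real.enorm_eq_ofReal_abs]
        refine ENNReal.ofReal_le_ofReal ?_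
        rw [← sub_nonneg, ← sq_abs]
        have : θ + |f y| ^ 2 / θ - |f y| = ((θ - |f y|) ^ 2 + θ * |f y|) / θ := by
          field_simp; ring
        rw [this]
        positivity
    _ = ENNReal.ofReal θ * volume A + ∫⁻ y in A, ENNReal.ofReal (f y ^ 2 / θ) := by
        rw [lintegral_add_left measurable_const, setLIntegral_const]
    _ ≤ ENNReal.ofReal θ * volume A + ENNReal.ofReal (b / θ) := by
        gcongr
        refine (setLIntegral_le_lintegral _ _).trans ?_
        rw [← ofReal_integral_eq_lintegral_ofReal (hi.div_const _)
          (ae_of_all _ fun y => by positivity), integral_div]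
        gcongr

/-- A finite family of cubes partitioning a set, in terms of indicator functions. -/
theorem integral_eq_sum_setIntegral_cube {ν : Measure 𝔼} {ι : Type} [Fintype ι]
    {c : ι → Fin d → ℝ} {ℓ : ι → ℝ} {P : Set 𝔼}
    (hid : ∀ x, P.indicator (fun _ => (1 : ℝ)) x
      = ∑ i, (cube (c i) (ℓ i)).indicator (fun _ => (1 : ℝ)) x)
    (hP : ∀ᵐ x ∂ν, x ∈ P) {f : 𝔼 → ℝ} (hf : Integrable f ν) :
    ∫ x, f x ∂ν = ∑ i, ∫ x in cube (c i) (ℓ i), f x ∂ν := by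
  simp_rw [← fun i => integral_indicator (μ := ν) (f := f) (measurableSet_cube (c i) (ℓ i))]
  rw [← integral_finsetSum _ fun i _ => hf.indicator (measurableSet_cube _ _)]
  refine integral_congr_ae ?_
  filter_upwards [hP] with x hx
  have h := hid x
  rw [indicator_of_mem hx] at h
  calc f x = (∑ i, (cube (c i) (ℓ i)).indicator (fun _ => (1 : ℝ)) x) * f x := by rw [← h, one_mul]
    _ = _ := by
      rw [Finset.sum_mul]
      refine Finset.sum_congr rfl fun i _ => ?_
      by_cases hi : x ∈ cube (c i) (ℓ i) <;> simp [hi]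

namespace FieldKernel

variable (K : FieldKernel d)

theorem hasCompactSupport_pderiv'_field (n : ℕ) (j k : Fin d) :
    HasCompactSupport (pderiv' j (K.field n k)) :=
  hasCompactSupport_pderiv' (K.hasCompactSupport_field n k) j

theorem setLIntegral_sub_center_le (n : ℕ) (j k : Fin d) {ν : Measure 𝔼} [SFinite ν] {s : 𝔼 → ℝ}
    (hs : AEStronglyMeasurable s ν) {c : 𝔼} {h : ℝ} (hν : ∀ᵐ x ∂ν, ‖x - c‖ ≤ h) {A : Set 𝔼}
    (hA : 1 < 2 ^ n * h → ∀ y ∈ A, 2 * h ≤ ‖y - c‖) :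
    ∫⁻ y in A, ‖∫ x, (pderiv' j (K.field n k) (y - x) - pderiv' j (K.field n k) (y - c)) * s x ∂ν‖ₑ
      ≤ K.hormander * ∫⁻ x, ‖s x‖ₑ ∂ν := by
  have hκ := K.continuous_pderiv'_field n j k
  refine lintegral_enorm_integral_le
    (κ := fun y x => pderiv' j (K.field n k) (y - x) - pderiv' j (K.field n k) (y - c))
    ((hκ.comp (by fun_prop)).sub (hκ.comp (by fun_prop))) hs ?_
  filter_upwards [hν] with x hx
  have h := (measurePreserving_add_right (volume : Measure 𝔼) c).setLIntegral_comp_preimage_emb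
    (measurableEmbedding_addRight c)
    (fun y => ‖pderiv' j (K.field n k) (y - x) - pderiv' j (K.field n k) (y - c)‖ₑ) A
  rw [← h]
  have e : ∀ z : 𝔼, z + c - x = z - (x - c) := fun z => by abel
  simp only [add_sub_cancel_right, e]
  refine K.lintegral_sub_le_hormander n j k hx fun h1 z hz => ?_
  simpa using hA h1 _ hz

/-- The constant in the weak-type estimate. -/
noncomputable def czConst : ℝ≥0∞ :=
  volume (closedBall (0 : 𝔼) (2 * d)) + ENNReal.ofReal ((2 * ∫ x, K.ζ x) ^ 2 * 2 ^ d)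
    + 2 * K.hormander

theorem czConst_ne_top : K.czConst ≠ (⊤ : ℝ≥0∞) :=
  ENNReal.add_ne_top.2 ⟨ENNReal.add_ne_top.2 ⟨(isCompact_closedBall _ _).measure_lt_top.ne,
    ENNReal.ofReal_ne_top⟩, ENNReal.mul_ne_top ENNReal.ofNat_ne_top K.hormander_ne_top⟩

/-- A weak-type estimate for the singular integral operators defined by the derivatives of the
field, with constants independent of the truncation. -/
theorem exists_exceptional_set (n : ℕ) (j k : Fin d) (ν : Measure 𝔼) [IsFiniteMeasure ν]
    (hν : ν (closedBall 0 3)ᶜ = 0) {s : 𝔼 → ℝ} (hs : Integrable s ν) {δ : ℝ}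
    (hδ1 : δ ≤ 1) (hsδ : ∫ x, |s x| ∂ν ≤ δ) {θ : ℝ} (hθ : 0 < θ) :
    ∃ E : Set 𝔼, MeasurableSet E ∧ volume E ≤ K.czConst * ENNReal.ofReal δ ∧
      ∫⁻ y in closedBall 0 2 \ E, ‖∫ x, pderiv' j (K.field n k) (y - x) * s x ∂ν‖ₑ
        ≤ ENNReal.ofReal θ * volume (closedBall (0 : 𝔼) 2)
          + K.czConst * ENNReal.ofReal (δ / θ) + K.czConst * ENNReal.ofReal δ := by
  have hδ0 : 0 ≤ δ := (integral_nonneg fun _ => abs_nonneg _).trans hsδ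
  set κ := pderiv' j (K.field n k) with hκd
  have hκ : Continuous κ := K.continuous_pderiv'_field n j k
  have hκc : HasCompactSupport κ := K.hasCompactSupport_pderiv'_field n j k
  set m : Measure 𝔼 := ν.withDensity fun x => ‖s x‖ₑ with hm
  have hmQ : ∀ a ℓ, m (cube a ℓ) = ENNReal.ofReal (∫ x in cube a ℓ, |s x| ∂ν) := fun a ℓ => by
    rw [hm, withDensity_apply _ (measurableSet_cube a ℓ),
      ← ofReal_integral_norm_eq_lintegral_enorm hs.integrableOn]
    rfl
  set P : Set 𝔼 := cube (fun _ => -(2 * 3)) (4 * 3) with hPd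
  have hP : ∀ᵐ x ∂ν, x ∈ P := by
    have : ∀ᵐ x ∂ν, x ∈ closedBall (0 : 𝔼) 3 := hν
    filter_upwards [this] with x hx using closedBall_subset_cube (by norm_num) hx
  obtain ⟨ι, hι, a, ℓ, hℓ, hid, hms, hor⟩ := exists_dyadic_decomposition m (n + d + 4)
    (fun _ : Fin d => -(2 * 3 : ℝ)) (ℓ := 4 * 3) (by norm_num) (by
      rw [hmQ]
      refine ENNReal.ofReal_le_ofReal ((setIntegral_le_integral hs.abs
        (ae_of_all _ fun _ => abs_nonneg _)).trans (hsδ.trans (hδ1.trans ?_)))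
      exact one_le_pow₀ (by norm_num))
  have hsum : ∑ i, ∫ x in cube (a i) (ℓ i), |s x| ∂ν ≤ δ := by
    rwa [← integral_eq_sum_setIntegral_cube hid hP hs.abs]
  have hσ : ∀ i, |∫ x in cube (a i) (ℓ i), s x ∂ν| ≤ ∫ x in cube (a i) (ℓ i), |s x| ∂ν :=
    fun i => abs_integral_le_integral_abs
  set w : ι → ℝ := fun i => (∫ x in cube (a i) (ℓ i), s x ∂ν) / ℓ i ^ d with hw
  have hwv : ∀ i, ℓ i ^ d * w i = ∫ x in cube (a i) (ℓ i), s x ∂ν := fun i =>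
    mul_div_cancel₀ _ (pow_pos (hℓ i) d).ne'
  have hvol : ∀ i, volume.real (cube (a i) (ℓ i)) = ℓ i ^ d := fun i => by
    rw [Measure.real, volume_cube _ (hℓ i).le, ENNReal.toReal_ofReal (pow_pos (hℓ i) d).le]
  have hfin : ∀ i, volume (cube (a i) (ℓ i)) ≠ ⊤ := fun i => by
    rw [volume_cube _ (hℓ i).le]; exact ENNReal.ofReal_ne_top
  have hwM : ∀ i, |w i| ≤ 2 ^ d := fun i => by
    rw [hw, abs_div, abs_of_pos (pow_pos (hℓ i) d), div_le_iff₀ (pow_pos (hℓ i) d), ← mul_pow]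
    refine (hσ i).trans ?_
    have := hms i
    rwa [hmQ, ENNReal.ofReal_le_ofReal_iff (pow_nonneg (by linarith [hℓ i]) d)] at this
  have hintg : ∀ y, Integrable (fun x => κ (y - x) * s x) ν := integrable_comp_sub_mul hκ hκc hs
  have hintv : ∀ y i, IntegrableOn (fun x => κ (y - x) * w i) (cube (a i) (ℓ i)) := fun y i =>
    integrable_comp_sub_mul hκ hκc (ν := volume.restrict _) (integrableOn_const (hfin i)) y
  set g : 𝔼 → ℝ := fun x => ∑ i, (cube (a i) (ℓ i)).indicator (fun _ => w i) x with hg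
  have hgP : ∀ x, |g x| ≤ 2 ^ d * P.indicator (fun _ => (1 : ℝ)) x := fun x => by
    rw [hid x, Finset.mul_sum]
    refine (Finset.abs_sum_le_sum_abs _ _).trans (Finset.sum_le_sum fun i _ => ?_)
    by_cases hi : x ∈ cube (a i) (ℓ i) <;> simp [hi, hwM i]
  have hgM : ∀ x, |g x| ≤ 2 ^ d := fun x => (hgP x).trans <|
    mul_le_of_le_one_right (by positivity) (indicator_le_self' (fun _ _ => zero_le_one) x)
  have hgi : Integrable g := integrable_finsetSum _ fun i _ =>
    (integrable_indicator_iff (measurableSet_cube _ _)).2 (integrableOn_const (hfin i))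
  have hgc : HasCompactSupport g := by
    refine HasCompactSupport.intro (isCompact_closedBall
      (WithLp.toLp 2 fun _ : Fin d => -(2 * 3 : ℝ)) (d * (4 * 3))) fun x hx => ?_
    have hxP : x ∉ P := fun h => hx (by
      rw [mem_closedBall, dist_eq_norm]; exact norm_sub_corner_le h)
    have := hgP x
    rw [indicator_of_notMem hxP, mul_zero] at this
    exact abs_nonpos_iff.1 this
  have hg1 : ∫ x, |g x| ≤ δ := by
    calc ∫ x, |g x| ≤ ∫ x, ∑ i, (cube (a i) (ℓ i)).indicator (fun _ => |w i|) x := by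
          refine integral_mono hgi.abs (integrable_finsetSum _ fun i _ =>
            (integrable_indicator_iff (measurableSet_cube _ _)).2
              (integrableOn_const (hfin i))) fun x => ?_
          refine (Finset.abs_sum_le_sum_abs _ _).trans_eq (Finset.sum_congr rfl fun i _ => ?_)
          by_cases hi : x ∈ cube (a i) (ℓ i) <;> simp [hi]
      _ = ∑ i, |∫ x in cube (a i) (ℓ i), s x ∂ν| := by
          rw [integral_finsetSum _ fun i _ => (integrable_indicator_iff
            (measurableSet_cube _ _)).2 (integrableOn_const (hfin i))]
          refine Finset.sum_congr rfl fun i _ => ?_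
          rw [integral_indicator (measurableSet_cube _ _), setIntegral_const, hvol, smul_eq_mul,
            ← hwv, abs_mul, abs_of_pos (pow_pos (hℓ i) d)]
      _ ≤ δ := (Finset.sum_le_sum fun i _ => hσ i).trans hsum
  have hgconv : ∀ y, ∫ x, κ (y - x) * g x = ∑ i, ∫ x in cube (a i) (ℓ i), κ (y - x) * w i :=
    fun y => by
    simp_rw [← fun i => integral_indicator (μ := volume) (f := fun x => κ (y - x) * w i)
      (measurableSet_cube (a i) (ℓ i))]
    rw [← integral_finsetSum _ fun i _ =>
      (integrable_indicator_iff (measurableSet_cube _ _)).2 (hintv y i)]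
    refine integral_congr_ae (ae_of_all _ fun x => ?_)
    simp only [hg, Finset.mul_sum]
    refine Finset.sum_congr rfl fun i _ => ?_
    by_cases hi : x ∈ cube (a i) (ℓ i) <;> simp [hi]
  set c : ι → 𝔼 := fun i => WithLp.toLp 2 (a i) with hc
  have hdec : ∀ y, ∫ x, κ (y - x) * s x ∂ν = (∫ x, κ (y - x) * g x)
      + ∑ i, ((∫ x in cube (a i) (ℓ i), (κ (y - x) - κ (y - c i)) * s x ∂ν)
        - ∫ x in cube (a i) (ℓ i), (κ (y - x) - κ (y - c i)) * w i) := fun y => by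
    rw [integral_eq_sum_setIntegral_cube hid hP (hintg y), hgconv, ← Finset.sum_add_distrib]
    refine Finset.sum_congr rfl fun i _ => ?_
    simp only [sub_mul]
    rw [integral_sub (hintg y).integrableOn (hs.integrableOn.const_mul _),
      integral_sub (hintv y i) (integrableOn_const (hfin i)), integral_const_mul,
      setIntegral_const, hvol, smul_eq_mul, ← hwv]
    ring
  set I := Finset.univ.filter fun i => ENNReal.ofReal (ℓ i ^ d) < m (cube (a i) (ℓ i)) with hI
  set E : Set 𝔼 := ⋃ i ∈ I, closedBall (c i) (2 * (d * ℓ i)) with hE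
  have hEm : MeasurableSet E := I.measurableSet_biUnion fun i _ => measurableSet_closedBall
  have hmsum : ∑ i, m (cube (a i) (ℓ i)) ≤ ENNReal.ofReal δ := by
    simp only [hmQ]
    rw [← ENNReal.ofReal_sum_of_nonneg fun i _ => integral_nonneg fun _ => abs_nonneg _]
    exact ENNReal.ofReal_le_ofReal hsum
  have hbad : ∀ i, 1 < 2 ^ n * (d * ℓ i) → ∀ y ∈ closedBall 0 2 \ E, 2 * (d * ℓ i) ≤ ‖y - c i‖ := by
    intro i hi y hy
    rcases hor i with h | h
    · by_contra hlt
      rw [not_le] at hlt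
      refine hy.2 (mem_biUnion (Finset.mem_coe.2 (Finset.mem_filter.2 ⟨Finset.mem_univ i, h⟩)) ?_)
      rw [mem_closedBall, dist_eq_norm]
      exact hlt.le
    · exfalso
      have hd2 : (d : ℝ) ≤ 2 ^ d := by exact_mod_cast (Nat.lt_two_pow_self (n := d)).le
      have : 2 ^ n * (d * ℓ i) ≤ 2 ^ n * (2 ^ d * (4 * 3 / 2 ^ (n + d + 4))) := by
        have := (hℓ i).le
        gcongr
      rw [pow_add, pow_add] at this
      have h2 : (2 : ℝ) ^ n * (2 ^ d * (4 * 3 / (2 ^ n * 2 ^ d * 2 ^ 4))) = 3 / 4 := by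
        field_simp; norm_num
      linarith
  have hnear : ∀ i, ∀ x ∈ cube (a i) (ℓ i), ‖x - c i‖ ≤ d * ℓ i := fun i x hx =>
    norm_sub_corner_le hx
  have hA : ∀ i, ∫⁻ y in closedBall 0 2 \ E,
      ‖∫ x in cube (a i) (ℓ i), (κ (y - x) - κ (y - c i)) * s x ∂ν‖ₑ
        ≤ K.hormander * m (cube (a i) (ℓ i)) := fun i => by
    rw [hm, withDensity_apply _ (measurableSet_cube _ _)]
    exact K.setLIntegral_sub_center_le n j k hs.aestronglyMeasurable.restrict
      (ae_restrict_of_forall_mem (measurableSet_cube _ _) (hnear i)) (hbad i)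
  have hB : ∀ i, ∫⁻ y in closedBall 0 2 \ E,
      ‖∫ x in cube (a i) (ℓ i), (κ (y - x) - κ (y - c i)) * w i‖ₑ
        ≤ K.hormander * m (cube (a i) (ℓ i)) := fun i => by
    refine (K.setLIntegral_sub_center_le n j k (s := fun _ => w i) aestronglyMeasurable_const
      (ae_restrict_of_forall_mem (measurableSet_cube _ _) (hnear i)) (hbad i)).trans ?_
    gcongr
    rw [setLIntegral_const, volume_cube _ (hℓ i).le, hmQ, Real.enorm_eq_ofReal_abs,
      ← ENNReal.ofReal_mul (abs_nonneg _)]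
    refine ENNReal.ofReal_le_ofReal (le_trans (le_of_eq ?_) (hσ i))
    rw [← hwv, abs_mul, abs_of_pos (pow_pos (hℓ i) d), mul_comm]
  have hsm : ∀ (α : Measure 𝔼) [SFinite α] (v : 𝔼 → ℝ), AEStronglyMeasurable v α → ∀ z : 𝔼,
      AEMeasurable (fun y => ‖∫ x, (κ (y - x) - κ (y - z)) * v x ∂α‖ₑ)
        (volume.restrict (closedBall 0 2 \ E)) := by
    intro α _ v hv z
    refine AEStronglyMeasurable.enorm ?_
    refine AEStronglyMeasurable.integral_prod_right'
      (f := fun p : 𝔼 × 𝔼 => (κ (p.1 - p.2) - κ (p.1 - z)) * v p.2) ?_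
    exact AEStronglyMeasurable.mul (((hκ.comp (by fun_prop)).sub
      (hκ.comp (by fun_prop))).aestronglyMeasurable) hv.comp_snd
  refine ⟨E, hEm, ?_, ?_⟩
  · calc volume E ≤ ∑ i ∈ I, volume (closedBall (c i) (2 * (d * ℓ i))) :=
          measure_biUnion_finset_le _ _
      _ ≤ ∑ i ∈ I, m (cube (a i) (ℓ i)) * volume (closedBall (0 : 𝔼) (2 * d)) := by
          refine Finset.sum_le_sum fun i hi => ?_
          rw [show 2 * (d * ℓ i) = ℓ i * (2 * d) by ring,
            Measure.addHaar_closedBall_mul _ _ (hℓ i).le (by positivity),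
            finrank_euclideanSpace_fin]
          gcongr
          exact (Finset.mem_filter.1 hi).2.le
      _ ≤ ENNReal.ofReal δ * volume (closedBall (0 : 𝔼) (2 * d)) := by
          rw [← Finset.sum_mul]
          gcongr
          exact (Finset.sum_le_sum_of_subset (Finset.subset_univ I)).trans hmsum
      _ ≤ K.czConst * ENNReal.ofReal δ := by
          rw [mul_comm]
          gcongr
          exact le_self_add.trans le_self_add
  · calc ∫⁻ y in closedBall 0 2 \ E, ‖∫ x, κ (y - x) * s x ∂ν‖ₑ
        ≤ ∫⁻ y in closedBall 0 2 \ E, (‖∫ x, κ (y - x) * g x‖ₑ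
            + ∑ i, (‖∫ x in cube (a i) (ℓ i), (κ (y - x) - κ (y - c i)) * s x ∂ν‖ₑ
              + ‖∫ x in cube (a i) (ℓ i), (κ (y - x) - κ (y - c i)) * w i‖ₑ)) := by
          refine lintegral_mono fun y => ?_
          rw [hdec y]
          refine (enorm_add_le _ _).trans ?_
          gcongr
          exact (enorm_sum_le _ _).trans (Finset.sum_le_sum fun i _ => enorm_sub_le)
      _ = (∫⁻ y in closedBall 0 2 \ E, ‖∫ x, κ (y - x) * g x‖ₑ)
            + ∑ i, ((∫⁻ y in closedBall 0 2 \ E,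
                ‖∫ x in cube (a i) (ℓ i), (κ (y - x) - κ (y - c i)) * s x ∂ν‖ₑ)
              + ∫⁻ y in closedBall 0 2 \ E,
                ‖∫ x in cube (a i) (ℓ i), (κ (y - x) - κ (y - c i)) * w i‖ₑ) := by
          have h1 := fun i => hsm (ν.restrict (cube (a i) (ℓ i))) s
            hs.aestronglyMeasurable.restrict (c i)
          have h2 := fun i => hsm (volume.restrict (cube (a i) (ℓ i))) (fun _ => w i)
            aestronglyMeasurable_const (c i)
          have h12 : ∀ i, AEMeasurable (fun y =>
              ‖∫ x in cube (a i) (ℓ i), (κ (y - x) - κ (y - c i)) * s x ∂ν‖ₑ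
                + ‖∫ x in cube (a i) (ℓ i), (κ (y - x) - κ (y - c i)) * w i‖ₑ)
              (volume.restrict (closedBall 0 2 \ E)) := fun i => (h1 i).add (h2 i)
          rw [lintegral_add_right' _ (Finset.aemeasurable_fun_sum _ fun i _ => h12 i),
            lintegral_finsetSum' _ fun i _ => h12 i]
          congr 1
          exact Finset.sum_congr rfl fun i _ => lintegral_add_left' (h1 i) _
      _ ≤ (ENNReal.ofReal θ * volume (closedBall (0 : 𝔼) 2)
            + ENNReal.ofReal ((2 * ∫ x, K.ζ x) ^ 2 * 2 ^ d * δ / θ))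
            + ∑ i, (K.hormander * m (cube (a i) (ℓ i)) + K.hormander * m (cube (a i) (ℓ i))) := by
          have hcont : Continuous fun y => ∫ x, κ (y - x) * g x :=
            (contDiff_zero (𝕜 := ℝ)).1 (contDiff_conv (n := 0) hgi.locallyIntegrable
              (contDiff_zero.2 hκ) hκc)
          gcongr with i _
          · refine (setLIntegral_enorm_le_of_sq hcont (hasCompactSupport_conv hgc hκc) hθ
              ((K.integral_sq_conv_le n j k hgi hgc hgM).trans
                (mul_le_mul_of_nonneg_left hg1 (by positivity))) _).trans ?_
            gcongr
            exact sdiff_subset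
          · exact hA i
          · exact hB i
      _ ≤ _ := by
          rw [mul_div_assoc, ENNReal.ofReal_mul (by positivity)]
          gcongr
          · exact le_add_self.trans le_self_add
          · rw [← Finset.sum_add_distrib.symm, ← Finset.mul_sum, ← two_mul, ← mul_assoc]
            gcongr
            exact le_add_self

end FieldKernel

theorem pderiv'_comp_const_sub {f : 𝔼 → ℝ} (hf : Differentiable ℝ f) (j : Fin d) (y x : 𝔼) :
    pderiv' j (fun x => f (y - x)) x = -pderiv' j f (y - x) := by
  have h := (hf (y - x)).hasFDerivAt.comp x ((hasFDerivAt_id x).const_sub y)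
  have h' : HasFDerivAt (fun x => f (y - x)) _ x := h
  simp [pderiv', h'.fderiv]

theorem tsupport_comp_const_sub_subset {f : 𝔼 → ℝ} {r : ℝ} (hf : tsupport f ⊆ closedBall 0 r)
    (y : 𝔼) : tsupport (fun x => f (y - x)) ⊆ closedBall y r := by
  refine closure_minimal (fun x hx => ?_) isClosed_closedBall
  have := hf (subset_tsupport f (show f (y - x) ≠ 0 from hx))
  rwa [mem_closedBall, dist_zero_right, ← dist_eq_norm, dist_comm] at this

/-- The measure `ν` almost solves `∇ν = 0` near the origin: the vector-valued measures
`(e_k - s_k) ν` have divergence `b_k ν`. -/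
def AlmostConstant (ν : Measure (EuclideanSpace ℝ (Fin d)))
    (s : Fin d → Fin d → EuclideanSpace ℝ (Fin d) → ℝ)
    (b : Fin d → EuclideanSpace ℝ (Fin d) → ℝ) : Prop :=
  ∀ k, ∀ φ : EuclideanSpace ℝ (Fin d) → ℝ, ContDiff ℝ ∞ φ → HasCompactSupport φ →
    tsupport φ ⊆ closedBall 0 3 →
      ∫ x, pderiv' k φ x ∂ν - ∑ j, ∫ x, pderiv' j φ x * s j k x ∂ν = ∫ x, φ x * b k x ∂ν

namespace FieldKernel

variable (K : FieldKernel d)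

theorem integral_ζ_eq (n : ℕ) {ν : Measure 𝔼} [IsFiniteMeasure ν] {s : Fin d → Fin d → 𝔼 → ℝ}
    {b : Fin d → 𝔼 → ℝ} (h : AlmostConstant ν s b) {y : 𝔼} (hy : y ∈ closedBall (0 : 𝔼) 2) :
    ∫ x, K.ζ (y - x) ∂ν = ∫ x, K.bump n (y - x) ∂ν
      - ∑ k, ∑ j, ∫ x, pderiv' j (K.field n k) (y - x) * s j k x ∂ν
      + ∑ k, ∫ x, K.field n k (y - x) * b k x ∂ν := by
  rw [mem_closedBall, dist_zero_right] at hy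
  have hone : ∀ {f : 𝔼 → ℝ}, Continuous f → HasCompactSupport f →
      Integrable (fun x => f (y - x)) ν := fun hf hc => by
    simpa using integrable_comp_sub_mul hf hc (integrable_const (μ := ν) (1 : ℝ)) y
  have hk : ∀ k, -∫ x, pderiv' k (K.field n k) (y - x) ∂ν
      + ∑ j, ∫ x, pderiv' j (K.field n k) (y - x) * s j k x ∂ν
      = ∫ x, K.field n k (y - x) * b k x ∂ν := by
    intro k
    have hts := tsupport_comp_const_sub_subset (K.tsupport_field n k) y
    have hdiff : Differentiable ℝ (K.field n k) := (K.contDiff_field n k).differentiable (by simp)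
    have := h k (fun x => K.field n k (y - x)) ((K.contDiff_field n k).comp (by fun_prop))
      ((isCompact_closedBall y 1).of_isClosed_subset (isClosed_tsupport _) hts)
      (hts.trans (closedBall_subset_closedBall' (by rw [dist_zero_right]; linarith)))
    simp only [pderiv'_comp_const_sub hdiff, neg_mul, integral_neg, Finset.sum_neg_distrib,
      sub_neg_eq_add] at this
    exact this
  have hsum := Finset.sum_congr rfl fun k (_ : k ∈ Finset.univ) => hk k
  rw [Finset.sum_add_distrib, Finset.sum_neg_distrib, ← integral_finsetSum _ fun k _ =>
    hone (K.continuous_pderiv'_field n k k) (K.hasCompactSupport_pderiv'_field n k k)] at hsum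
  simp only [K.div_field_eq] at hsum
  rw [integral_sub (hone (K.continuous_bump n) (K.hasCompactSupport_bump n))
    (hone (K.continuous_bump 0) (K.hasCompactSupport_bump 0)), bump_zero] at hsum
  linarith

theorem lintegral_bump_conv_le (n : ℕ) {ν : Measure 𝔼} [IsFiniteMeasure ν] (C : Set 𝔼) :
    ∫⁻ y in (cthickening (1 / 2 ^ n) C)ᶜ, ‖∫ x, K.bump n (y - x) ∂ν‖ₑ
      ≤ ENNReal.ofReal (∫ x, K.ζ x) * ν Cᶜ := by
  have hcont := K.continuous_bump n
  calc ∫⁻ y in (cthickening (1 / 2 ^ n) C)ᶜ, ‖∫ x, K.bump n (y - x) ∂ν‖ₑ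
      = ∫⁻ y in (cthickening (1 / 2 ^ n) C)ᶜ, ‖∫ x in Cᶜ, K.bump n (y - x) * 1 ∂ν‖ₑ := by
        refine setLIntegral_congr_fun isClosed_cthickening.measurableSet.compl fun y hy => ?_
        simp only [mul_one]
        rw [setIntegral_eq_integral_of_forall_compl_eq_zero fun x hx => ?_]
        rw [notMem_compl_iff] at hx
        refine K.bump_eq_zero ?_
        by_contra hle
        rw [not_lt] at hle
        refine hy (mem_cthickening_of_dist_le y x _ _ hx ?_)
        rw [dist_eq_norm, le_div_iff₀ (by positivity), mul_comm]
        exact hle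
    _ ≤ ENNReal.ofReal (∫ x, K.ζ x) * ∫⁻ _x in Cᶜ, ‖(1 : ℝ)‖ₑ ∂ν := by
        refine lintegral_enorm_integral_le (κ := fun y x => K.bump n (y - x))
          (s := fun _ => 1) (hcont.comp (by fun_prop)) aestronglyMeasurable_const
          (ae_of_all _ fun x => (setLIntegral_le_lintegral _ _).trans_eq ?_)
        rw [lintegral_sub_right_eq_self (fun y => ‖K.bump n y‖ₑ) x, lintegral_bump]
    _ = _ := by simp

theorem lintegral_field_conv_le (n : ℕ) (k : Fin d) {ν : Measure 𝔼} [IsFiniteMeasure ν]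
    {b : 𝔼 → ℝ} (hb : Integrable b ν) (A : Set 𝔼) :
    ∫⁻ y in A, ‖∫ x, K.field n k (y - x) * b x ∂ν‖ₑ
      ≤ (2 * ∫⁻ x, ‖K.V k x‖ₑ) * ENNReal.ofReal (∫ x, |b x| ∂ν) := by
  have := lintegral_enorm_integral_le (κ := fun y x => K.field n k (y - x))
    (ν := ν) (α := volume.restrict A) (s := b)
    ((K.contDiff_field n k).continuous.comp (by fun_prop)) hb.aestronglyMeasurable
    (ae_of_all _ fun x => (setLIntegral_le_lintegral _ _).trans
      ((lintegral_sub_right_eq_self (fun y => ‖K.field n k y‖ₑ) x).trans_le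
        (K.lintegral_field_le n k)))
  rwa [← ofReal_integral_norm_eq_lintegral_enorm hb] at this

theorem mul_measure_closedBall_le (ν : Measure 𝔼) [IsFiniteMeasure ν] :
    ENNReal.ofReal (∫ x, K.ζ x) * ν (closedBall 0 1)
      ≤ ∫⁻ y in closedBall 0 2, ‖∫ x, K.ζ (y - x) ∂ν‖ₑ := by
  have hc := K.ζ_cont
  have hone : ∀ y : 𝔼, Integrable (fun x => K.ζ (y - x)) ν := fun y => by
    simpa using integrable_comp_sub_mul hc K.hasCompactSupport_ζ
      (integrable_const (μ := ν) (1 : ℝ)) y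
  have hm : Measurable fun p : 𝔼 × 𝔼 => ‖K.ζ (p.1 - p.2)‖ₑ :=
    (hc.comp (by fun_prop : Continuous fun p : 𝔼 × 𝔼 => p.1 - p.2)).measurable.enorm
  calc ENNReal.ofReal (∫ x, K.ζ x) * ν (closedBall 0 1)
      = ∫⁻ _x in closedBall 0 1, ENNReal.ofReal (∫ x, K.ζ x) ∂ν := by rw [setLIntegral_const]
    _ ≤ ∫⁻ x in closedBall 0 1, (∫⁻ y in closedBall 0 2, ‖K.ζ (y - x)‖ₑ) ∂ν := by
        refine setLIntegral_mono' measurableSet_closedBall fun x hx => ?_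
        rw [mem_closedBall, dist_zero_right] at hx
        rw [setLIntegral_eq_of_support_subset, lintegral_sub_right_eq_self (fun y => ‖K.ζ y‖ₑ) x,
          ← K.bump_zero, lintegral_bump, bump_zero]
        intro y hy
        have h0 : K.ζ (y - x) ≠ 0 := fun h0 => hy (by simp [h0])
        have := K.ζ_support h0
        rw [mem_closedBall, dist_zero_right] at this ⊢
        have := norm_sub_norm_le y x
        linarith
    _ ≤ ∫⁻ x, (∫⁻ y in closedBall 0 2, ‖K.ζ (y - x)‖ₑ) ∂ν := setLIntegral_le_lintegral _ _
    _ = ∫⁻ y in closedBall 0 2, ∫⁻ x, ‖K.ζ (y - x)‖ₑ ∂ν :=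
        (lintegral_lintegral_swap hm.aemeasurable).symm
    _ = _ := by
        refine lintegral_congr fun y => ?_
        rw [← ofReal_integral_norm_eq_lintegral_enorm (hone y), Real.enorm_eq_ofReal_abs,
          abs_of_nonneg (integral_nonneg fun x => K.ζ_nonneg _)]
        simp only [Real.norm_eq_abs, abs_of_nonneg (K.ζ_nonneg _)]

end FieldKernel

namespace FieldKernel

variable (K : FieldKernel d)

/-- An upper bound for the bump. -/
noncomputable def sup : ℝ :=
  (K.hasCompactSupport_ζ.exists_bound_of_continuous K.ζ_cont).choose

theorem enorm_integral_ζ_le {ν : Measure 𝔼} (h1 : ν univ ≤ 1) (y : 𝔼) :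
    ‖∫ x, K.ζ (y - x) ∂ν‖ₑ ≤ ENNReal.ofReal K.sup := by
  refine (enorm_integral_le_lintegral_enorm _).trans ?_
  calc ∫⁻ x, ‖K.ζ (y - x)‖ₑ ∂ν ≤ ∫⁻ _x, ENNReal.ofReal K.sup ∂ν := by
        refine lintegral_mono fun x => ?_
        rw [← ofReal_norm]
        exact ENNReal.ofReal_le_ofReal
          ((K.hasCompactSupport_ζ.exists_bound_of_continuous K.ζ_cont).choose_spec _)
    _ = ENNReal.ofReal K.sup * ν univ := lintegral_const _
    _ ≤ ENNReal.ofReal K.sup * 1 := by gcongr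
    _ = _ := mul_one _

/-- The constant in the estimate of the mass of an almost constant measure. -/
noncomputable def massConst : ℝ≥0∞ :=
  ENNReal.ofReal K.sup * (1 + ∑ _k : Fin d, ∑ _j : Fin d, K.czConst)
    + (ENNReal.ofReal (∫ x, K.ζ x) * 2
      + ∑ _k : Fin d, ∑ _j : Fin d, (volume (closedBall (0 : 𝔼) 2) + K.czConst + K.czConst)
      + ∑ k, 2 * ∫⁻ x, ‖K.V k x‖ₑ)

theorem massConst_ne_top : K.massConst ≠ (⊤ : ℝ≥0∞) := by
  have h1 := K.czConst_ne_top
  have h2 : volume (closedBall (0 : 𝔼) 2) ≠ ⊤ := (isCompact_closedBall _ _).measure_lt_top.ne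
  have h3 : ∀ k, ∫⁻ x, ‖K.V k x‖ₑ ≠ ⊤ := fun k =>
    ((K.smooth k).continuous.integrable_of_hasCompactSupport (K.hasCompactSupport_V k)).2.ne
  have h4 : ∀ k ∈ Finset.univ, 2 * ∫⁻ x, ‖K.V k x‖ₑ ≠ ⊤ := fun k _ =>
    ENNReal.mul_ne_top ENNReal.ofNat_ne_top (h3 k)
  exact ENNReal.add_ne_top.2 ⟨ENNReal.mul_ne_top ENNReal.ofReal_ne_top (ENNReal.add_ne_top.2
    ⟨ENNReal.one_ne_top, ENNReal.sum_ne_top.2 fun _ _ => ENNReal.sum_ne_top.2 fun _ _ => h1⟩),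
    ENNReal.add_ne_top.2 ⟨ENNReal.add_ne_top.2
      ⟨ENNReal.mul_ne_top ENNReal.ofReal_ne_top ENNReal.ofNat_ne_top,
        ENNReal.sum_ne_top.2 fun _ _ => ENNReal.sum_ne_top.2 fun _ _ =>
          ENNReal.add_ne_top.2 ⟨ENNReal.add_ne_top.2 ⟨h2, h1⟩, h1⟩⟩, ENNReal.sum_ne_top.2 h4⟩⟩

theorem mul_measure_closedBall_le_massConst {η : ℝ} (hη0 : 0 < η) (hη1 : η ≤ 1) (ν : Measure 𝔼)
    [IsFiniteMeasure ν] (h1 : ν univ ≤ 1) (h3 : ν (closedBall 0 3)ᶜ = 0)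
    {s : Fin d → Fin d → 𝔼 → ℝ} {b : Fin d → 𝔼 → ℝ} (hs : ∀ j k, Integrable (s j k) ν)
    (hb : ∀ k, Integrable (b k) ν) (h : AlmostConstant ν s b)
    (hsη : ∀ j k, ∫ x, |s j k x| ∂ν ≤ η ^ 2) (hbη : ∀ k, ∫ x, |b k x| ∂ν ≤ η ^ 2)
    {N : Set 𝔼} (hN : MeasurableSet N) (hN0 : volume N = 0)
    (hνN : ν Nᶜ ≤ ENNReal.ofReal (η ^ 2)) :
    ENNReal.ofReal (∫ x, K.ζ x) * ν (closedBall 0 1) ≤ K.massConst * ENNReal.ofReal η := by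
  set w := ENNReal.ofReal η with hw
  have hηη : η ^ 2 ≤ η := by nlinarith
  have hw2 : ENNReal.ofReal (η ^ 2) ≤ w := ENNReal.ofReal_le_ofReal hηη
  have hw0 : w ≠ 0 := by simpa [hw] using hη0
  obtain ⟨C, hCN, hC, hCν⟩ := hN.exists_isCompact_sdiff_lt (measure_ne_top ν N) hw0
  have hC2 : ν Cᶜ ≤ 2 * w := by
    calc ν Cᶜ ≤ ν (N \ C ∪ Nᶜ) := measure_mono fun x hx => by
          by_cases hxN : x ∈ N
          · exact Or.inl ⟨hxN, hx⟩
          · exact Or.inr hxN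
      _ ≤ ν (N \ C) + ν Nᶜ := measure_union_le _ _
      _ ≤ w + w := add_le_add hCν.le (hνN.trans hw2)
      _ = 2 * w := (two_mul w).symm
  obtain ⟨n, hn⟩ : ∃ n : ℕ, volume (cthickening (1 / 2 ^ n) C) ≤ w := by
    have ht := tendsto_measure_cthickening_of_isCompact (μ := (volume : Measure 𝔼)) hC
    rw [measure_mono_null hCN hN0] at ht
    have ht2 : Tendsto (fun n : ℕ => (1 : ℝ) / 2 ^ n) atTop (𝓝 0) := by
      simpa [one_div] using tendsto_pow_atTop_nhds_zero_of_lt_one (r := (1 / 2 : ℝ))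
        (by norm_num) (by norm_num)
    obtain ⟨n, hn⟩ := ((ht.comp ht2).eventually (gt_mem_nhds (pos_iff_ne_zero.2 hw0))).exists
    exact ⟨n, hn.le⟩
  have hcz := fun k j => K.exists_exceptional_set n j k ν h3 (hs j k) (δ := η ^ 2) (by nlinarith)
    (hsη j k) hη0
  choose E hEm hEv hEi using hcz
  set U := cthickening (1 / 2 ^ n) C with hU
  set B : Set 𝔼 := U ∪ ⋃ k, ⋃ j, E k j with hB
  have hBm : MeasurableSet B := isClosed_cthickening.measurableSet.union
    (MeasurableSet.iUnion fun k => MeasurableSet.iUnion fun j => hEm k j)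
  have hBv : volume B ≤ (1 + ∑ _k : Fin d, ∑ _j : Fin d, K.czConst) * w := by
    refine (measure_union_le _ _).trans ?_
    rw [add_mul, one_mul]
    gcongr
    rw [Finset.sum_mul]
    refine (measure_iUnion_fintype_le _ _).trans (Finset.sum_le_sum fun k _ => ?_)
    rw [Finset.sum_mul]
    refine (measure_iUnion_fintype_le _ _).trans (Finset.sum_le_sum fun j _ => ?_)
    exact (hEv k j).trans (by gcongr)
  have hgood : ∫⁻ y in closedBall 0 2 \ B, ‖∫ x, K.ζ (y - x) ∂ν‖ₑ
      ≤ (ENNReal.ofReal (∫ x, K.ζ x) * 2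
      + ∑ _k : Fin d, ∑ _j : Fin d, (volume (closedBall (0 : 𝔼) 2) + K.czConst + K.czConst)
      + ∑ k, 2 * ∫⁻ x, ‖K.V k x‖ₑ) * w := by
    have hm : ∀ {κ : 𝔼 → ℝ} {v : 𝔼 → ℝ}, Continuous κ → AEStronglyMeasurable v ν →
        AEMeasurable (fun y => ‖∫ x, κ (y - x) * v x ∂ν‖ₑ)
          (volume.restrict (closedBall 0 2 \ B)) := by
      intro κ v hκ hv
      refine AEStronglyMeasurable.enorm ?_
      refine AEStronglyMeasurable.integral_prod_right'
        (f := fun p : 𝔼 × 𝔼 => κ (p.1 - p.2) * v p.2) ?_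
      exact AEStronglyMeasurable.mul (hκ.comp (by fun_prop)).aestronglyMeasurable hv.comp_snd
    have hm1 : AEMeasurable (fun y => ‖∫ x, K.bump n (y - x) ∂ν‖ₑ)
        (volume.restrict (closedBall 0 2 \ B)) := by
      simpa using hm (K.continuous_bump n) (aestronglyMeasurable_const (b := (1 : ℝ)))
    have hm2 := fun k j => hm (K.continuous_pderiv'_field n j k) (hs j k).aestronglyMeasurable
    have hm3 := fun k => hm (K.contDiff_field n k).continuous (hb k).aestronglyMeasurable
    have hm2' := Finset.aemeasurable_fun_sum (Finset.univ : Finset (Fin d)) fun k _ =>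
      Finset.aemeasurable_fun_sum (Finset.univ : Finset (Fin d)) fun j _ => hm2 k j
    calc ∫⁻ y in closedBall 0 2 \ B, ‖∫ x, K.ζ (y - x) ∂ν‖ₑ
        ≤ ∫⁻ y in closedBall 0 2 \ B, (‖∫ x, K.bump n (y - x) ∂ν‖ₑ
          + ∑ k, ∑ j, ‖∫ x, pderiv' j (K.field n k) (y - x) * s j k x ∂ν‖ₑ
          + ∑ k, ‖∫ x, K.field n k (y - x) * b k x ∂ν‖ₑ) := by
          refine setLIntegral_mono' (measurableSet_closedBall.diff hBm) fun y hy => ?_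
          rw [K.integral_ζ_eq n h hy.1]
          refine (enorm_add_le _ _).trans (add_le_add (enorm_sub_le.trans (add_le_add le_rfl ?_))
            (enorm_sum_le _ _))
          exact (enorm_sum_le _ _).trans (Finset.sum_le_sum fun k _ => enorm_sum_le _ _)
      _ = (∫⁻ y in closedBall 0 2 \ B, ‖∫ x, K.bump n (y - x) ∂ν‖ₑ)
          + ∑ k, ∑ j, (∫⁻ y in closedBall 0 2 \ B,
            ‖∫ x, pderiv' j (K.field n k) (y - x) * s j k x ∂ν‖ₑ)
          + ∑ k, ∫⁻ y in closedBall 0 2 \ B, ‖∫ x, K.field n k (y - x) * b k x ∂ν‖ₑ := by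
          rw [lintegral_add_right' _ (Finset.aemeasurable_fun_sum _ fun k _ => hm3 k),
            lintegral_add_right' _ hm2', lintegral_finsetSum' _ fun k _ => hm3 k,
            lintegral_finsetSum' _ fun k _ => Finset.aemeasurable_fun_sum _ fun j _ => hm2 k j]
          congr 2
          exact Finset.sum_congr rfl fun k _ => lintegral_finsetSum' _ fun j _ => hm2 k j
      _ ≤ ENNReal.ofReal (∫ x, K.ζ x) * (2 * w)
          + ∑ _k : Fin d, ∑ _j : Fin d, (w * volume (closedBall (0 : 𝔼) 2)
            + K.czConst * w + K.czConst * w)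
          + ∑ k, (2 * ∫⁻ x, ‖K.V k x‖ₑ) * w := by
          refine add_le_add (add_le_add ?_ ?_) ?_
          · refine (lintegral_mono_set fun y hy => ?_).trans
              ((K.lintegral_bump_conv_le n C).trans (by gcongr))
            exact fun hyU => hy.2 (Or.inl hyU)
          · refine Finset.sum_le_sum fun k _ => Finset.sum_le_sum fun j _ => ?_
            refine (lintegral_mono_set fun y hy => ?_).trans ((hEi k j).trans ?_)
            · exact ⟨hy.1, fun hyE => hy.2 (Or.inr (mem_iUnion₂.2 ⟨k, j, hyE⟩))⟩
            · rw [show η ^ 2 / η = η by field_simp]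
              gcongr
          · refine Finset.sum_le_sum fun k _ => (K.lintegral_field_conv_le n k (hb k) _).trans ?_
            gcongr
            exact ENNReal.ofReal_le_ofReal ((hbη k).trans hηη)
      _ = _ := by
          simp only [add_mul, Finset.sum_mul, mul_assoc]
          simp only [mul_comm w]
  calc ENNReal.ofReal (∫ x, K.ζ x) * ν (closedBall 0 1)
      ≤ ∫⁻ y in closedBall 0 2, ‖∫ x, K.ζ (y - x) ∂ν‖ₑ := K.mul_measure_closedBall_le ν
    _ ≤ ∫⁻ y in B ∪ (closedBall 0 2 \ B), ‖∫ x, K.ζ (y - x) ∂ν‖ₑ :=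
        lintegral_mono_set fun y hy => by
          by_cases hyB : y ∈ B
          · exact Or.inl hyB
          · exact Or.inr ⟨hy, hyB⟩
    _ ≤ (∫⁻ y in B, ‖∫ x, K.ζ (y - x) ∂ν‖ₑ)
        + ∫⁻ y in closedBall 0 2 \ B, ‖∫ x, K.ζ (y - x) ∂ν‖ₑ := lintegral_union_le _ _ _
    _ ≤ ENNReal.ofReal K.sup * ((1 + ∑ _k : Fin d, ∑ _j : Fin d, K.czConst) * w) + _ := by
        refine add_le_add ?_ hgood
        calc _ ≤ ∫⁻ _y in B, ENNReal.ofReal K.sup :=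
              lintegral_mono fun y => K.enorm_integral_ζ_le h1 y
          _ = ENNReal.ofReal K.sup * volume B := setLIntegral_const _ _
          _ ≤ _ := by gcongr
    _ = K.massConst * w := by
        rw [massConst, add_mul (ENNReal.ofReal K.sup * _), mul_assoc (ENNReal.ofReal K.sup)]

end FieldKernel

/-- An almost constant probability measure which is almost singular has little mass in the
unit ball. -/
theorem exists_small_mass (hd : 0 < d) {c : ℝ} (hc : 0 < c) : ∃ δ : ℝ, 0 < δ ∧
    ∀ (ν : Measure 𝔼) [IsFiniteMeasure ν], ν univ ≤ 1 → ν (closedBall 0 3)ᶜ = 0 →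
    ∀ (s : Fin d → Fin d → 𝔼 → ℝ) (b : Fin d → 𝔼 → ℝ), (∀ j k, Integrable (s j k) ν) →
    (∀ k, Integrable (b k) ν) → AlmostConstant ν s b → (∀ j k, ∫ x, |s j k x| ∂ν ≤ δ) →
    (∀ k, ∫ x, |b k x| ∂ν ≤ δ) → ∀ N : Set 𝔼, MeasurableSet N → volume N = 0 →
    ν Nᶜ ≤ ENNReal.ofReal δ → ν (closedBall 0 1) ≤ ENNReal.ofReal c := by
  obtain ⟨K⟩ := exists_fieldKernel hd
  have hZ := K.ζ_pos
  set M := K.massConst.toReal with hM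
  have hM0 : 0 ≤ M := ENNReal.toReal_nonneg
  set η := min 1 (c * (∫ x, K.ζ x) / (M + 1)) with hη
  have hη0 : 0 < η := lt_min one_pos (by positivity)
  have hηM : M * η ≤ c * ∫ x, K.ζ x := by
    have h1 : η ≤ c * (∫ x, K.ζ x) / (M + 1) := min_le_right _ _
    rw [le_div_iff₀ (by positivity)] at h1
    linarith
  refine ⟨η ^ 2, by positivity, fun ν _ h1 h3 s b hs hb h hsη hbη N hN hN0 hνN => ?_⟩
  have := K.mul_measure_closedBall_le_massConst hη0 (min_le_left _ _) ν h1 h3 hs hb h hsη hbη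
    hN hN0 hνN
  rw [← ENNReal.ofReal_toReal K.massConst_ne_top, ← ENNReal.ofReal_mul hM0] at this
  have h2 := this.trans (ENNReal.ofReal_le_ofReal hηM)
  rw [mul_comm c, ENNReal.ofReal_mul hZ.le] at h2
  exact (ENNReal.mul_le_mul_iff_right (by simpa using hZ) ENNReal.ofReal_ne_top).1 h2

/-- The homothety which maps the ball of radius `r` about `x₀` to the unit ball. -/
noncomputable def homothety (x₀ : 𝔼) {r : ℝ} (hr : 0 < r) : 𝔼 ≃ₜ 𝔼 :=
  (Homeomorph.subRight x₀).trans (Homeomorph.smulOfNeZero r⁻¹ (inv_ne_zero hr.ne'))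

theorem homothety_apply (x₀ : 𝔼) {r : ℝ} (hr : 0 < r) (x : 𝔼) :
    homothety x₀ hr x = r⁻¹ • (x - x₀) := rfl

theorem homothety_preimage_closedBall (x₀ : 𝔼) {r : ℝ} (hr : 0 < r) (R : ℝ) :
    homothety x₀ hr ⁻¹' closedBall 0 R = closedBall x₀ (R * r) := by
  ext x
  rw [mem_preimage, mem_closedBall_zero_iff, homothety_apply, norm_smul, norm_inv,
    Real.norm_of_nonneg hr.le, mem_closedBall, dist_eq_norm, inv_mul_le_iff₀ hr, mul_comm]

theorem contDiff_homothety (x₀ : 𝔼) {r : ℝ} (hr : 0 < r) : ContDiff ℝ ∞ (homothety x₀ hr) :=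
  show ContDiff ℝ ∞ fun x => r⁻¹ • (x - x₀) by fun_prop

theorem pderiv'_comp_homothety (x₀ : 𝔼) {r : ℝ} (hr : 0 < r) (j : Fin d) {φ : 𝔼 → ℝ}
    (hφ : Differentiable ℝ φ) (x : 𝔼) :
    pderiv' j (fun x => φ (homothety x₀ hr x)) x = r⁻¹ * pderiv' j φ (homothety x₀ hr x) := by
  have h1 : HasFDerivAt (fun x => homothety x₀ hr x) (r⁻¹ • ContinuousLinearMap.id ℝ 𝔼) x :=
    ((hasFDerivAt_id x).sub_const x₀).const_smul r⁻¹
  have h2 := ((hφ (homothety x₀ hr x)).hasFDerivAt.comp x h1).fderiv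
  have h3 : (fun x => φ (homothety x₀ hr x)) = φ ∘ fun x => homothety x₀ hr x := rfl
  rw [pderiv', h3, h2]
  simp [pderiv']

/-- The normalised restriction of a measure to the ball of radius `3 * r` about `x₀`, rescaled to
the ball of radius `3` about the origin. -/
noncomputable def blowUp (m : Measure 𝔼) (x₀ : 𝔼) {r : ℝ} (hr : 0 < r) : Measure 𝔼 :=
  (m (closedBall x₀ (3 * r)))⁻¹ •
    (m.restrict (closedBall x₀ (3 * r))).map (homothety x₀ hr)

theorem blowUp_apply (m : Measure 𝔼) (x₀ : 𝔼) {r : ℝ} (hr : 0 < r) (S : Set 𝔼) :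
    blowUp m x₀ hr S = (m (closedBall x₀ (3 * r)))⁻¹ *
      m (homothety x₀ hr ⁻¹' S ∩ closedBall x₀ (3 * r)) := by
  rw [blowUp, Measure.smul_apply, smul_eq_mul, (homothety x₀ hr).measurableEmbedding.map_apply,
    Measure.restrict_apply' measurableSet_closedBall]

theorem integral_blowUp (m : Measure 𝔼) (x₀ : 𝔼) {r : ℝ} (hr : 0 < r) (f : 𝔼 → ℝ) :
    ∫ y, f y ∂(blowUp m x₀ hr) = (m.real (closedBall x₀ (3 * r)))⁻¹ *
      ∫ x in closedBall x₀ (3 * r), f (homothety x₀ hr x) ∂m := by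
  rw [blowUp, integral_smul_measure, (homothety x₀ hr).measurableEmbedding.integral_map,
    ENNReal.toReal_inv, smul_eq_mul, Measure.real]

theorem integrable_blowUp {m : Measure 𝔼} {x₀ : 𝔼} {r : ℝ} (hr : 0 < r)
    (h0 : m (closedBall x₀ (3 * r)) ≠ 0) {f : 𝔼 → ℝ}
    (hf : Integrable (fun x => f (homothety x₀ hr x)) m) : Integrable f (blowUp m x₀ hr) := by
  refine Integrable.smul_measure ?_ (by simpa using h0)
  rw [(homothety x₀ hr).measurableEmbedding.integrable_map_iff]
  exact hf.restrict

/-- The matrix valued measure `a • m` has row divergence `-b • m` on `Ω`. -/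
def HasDivergence (Ω : Set 𝔼) (m : Measure 𝔼) (a : Fin d → Fin d → 𝔼 → ℝ)
    (b : Fin d → 𝔼 → ℝ) : Prop :=
  ∀ k, ∀ φ : 𝔼 → ℝ, ContDiff ℝ ∞ φ → HasCompactSupport φ → tsupport φ ⊆ Ω →
    ∑ j, ∫ x, pderiv' j φ x * a j k x ∂m = ∫ x, φ x * b k x ∂m

theorem almostConstant_blowUp {Ω : Set 𝔼} {m : Measure 𝔼} [IsFiniteMeasure m]
    {a : Fin d → Fin d → 𝔼 → ℝ} {b : Fin d → 𝔼 → ℝ} (ha : ∀ j k, Integrable (a j k) m)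
    (h : HasDivergence Ω m a b) {x₀ : 𝔼} {r : ℝ} (hr : 0 < r)
    (hΩ : closedBall x₀ (3 * r) ⊆ Ω) :
    AlmostConstant (blowUp m x₀ hr)
      (fun j k y => (1 : Matrix (Fin d) (Fin d) ℝ) j k - a j k ((homothety x₀ hr).symm y))
      (fun k y => r * b k ((homothety x₀ hr).symm y)) := by
  intro k φ hφ hφc hφs
  have hts : tsupport (fun x => φ (homothety x₀ hr x)) ⊆ closedBall x₀ (3 * r) := by
    refine closure_minimal (fun x hx => ?_) isClosed_closedBall
    rw [← homothety_preimage_closedBall x₀ hr]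
    exact hφs (subset_closure hx)
  have hsm : ContDiff ℝ ∞ (fun x => φ (homothety x₀ hr x)) :=
    hφ.comp (contDiff_homothety x₀ hr)
  have key := h k _ hsm (hφc.comp_homeomorph _) (hts.trans hΩ)
  have hres : ∀ {f g : 𝔼 → ℝ}, tsupport f ⊆ closedBall x₀ (3 * r) →
      ∫ x in closedBall x₀ (3 * r), f x * g x ∂m = ∫ x, f x * g x ∂m := fun hf =>
    setIntegral_eq_integral_of_forall_compl_eq_zero fun x hx => by
      rw [image_eq_zero_of_notMem_tsupport fun hx' => hx (hf hx'), zero_mul]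
  have hc : ∀ j, Continuous (pderiv' j φ) := fun j => (contDiff_pderiv' (n := 0) (hφ.of_le (by simp)) j).continuous
  have hb : ∀ j, ∃ C, ∀ x, ‖pderiv' j φ x‖ ≤ C := fun j =>
    (hasCompactSupport_pderiv' hφc j).exists_bound_of_continuous (hc j)
  have hi : ∀ j, Integrable (fun x => pderiv' j φ (homothety x₀ hr x) * a j k x) m := fun j =>
    (ha j k).bdd_mul ((hc j).comp (homothety x₀ hr).continuous).aestronglyMeasurable
      (.of_forall fun x => (hb j).choose_spec _)
  have hi1 : ∀ j, Integrable (fun x => pderiv' j φ (homothety x₀ hr x)) m := fun j =>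
    Integrable.of_bound ((hc j).comp (homothety x₀ hr).continuous).aestronglyMeasurable _
      (.of_forall fun x => (hb j).choose_spec _)
  have hsum : ∑ j, ∫ x in closedBall x₀ (3 * r),
        pderiv' j φ (homothety x₀ hr x) * a j k x ∂m
      = r * ∫ x in closedBall x₀ (3 * r), φ (homothety x₀ hr x) * b k x ∂m := by
    rw [hres hts, ← key, Finset.mul_sum]
    refine Finset.sum_congr rfl fun j _ => ?_
    rw [← hres (Subset.trans (tsupport_pderiv'_subset j) hts), ← integral_const_mul]
    refine integral_congr_ae (.of_forall fun x => ?_)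
    simp only
    rw [pderiv'_comp_homothety x₀ hr j (hφ.differentiable (by simp)), ← mul_assoc, ← mul_assoc,
      mul_inv_cancel₀ hr.ne', one_mul]
  simp only [integral_blowUp, Homeomorph.symm_apply_apply, ← Finset.mul_sum, ← mul_sub]
  congr 1
  have e1 : ∀ j, ∫ x in closedBall x₀ (3 * r), pderiv' j φ (homothety x₀ hr x) *
      ((1 : Matrix (Fin d) (Fin d) ℝ) j k - a j k x) ∂m
      = (1 : Matrix (Fin d) (Fin d) ℝ) j k *
          ∫ x in closedBall x₀ (3 * r), pderiv' j φ (homothety x₀ hr x) ∂m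
        - ∫ x in closedBall x₀ (3 * r), pderiv' j φ (homothety x₀ hr x) * a j k x ∂m := fun j => by
    rw [← integral_const_mul, ← integral_sub ((hi1 j).const_mul _).restrict (hi j).restrict]
    exact integral_congr_ae (.of_forall fun x => by ring)
  rw [Finset.sum_congr rfl fun j _ => e1 j, Finset.sum_sub_distrib, hsum]
  simp only [Matrix.one_apply, ite_mul, one_mul, zero_mul, Finset.sum_ite_eq', Finset.mem_univ,
    if_true, _root_.sub_sub_cancel]
  rw [← integral_const_mul]
  exact integral_congr_ae (.of_forall fun x => by ring)

theorem exists_measure_closedBall_le (hd : 0 < d) {c : ℝ} (hc : 0 < c) : ∃ ε : ℝ, 0 < ε ∧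
    ∀ {Ω : Set 𝔼} {m : Measure 𝔼} [IsFiniteMeasure m] {a : Fin d → Fin d → 𝔼 → ℝ}
    {b : Fin d → 𝔼 → ℝ}, (∀ j k, Integrable (a j k) m) → (∀ k, Integrable (b k) m) →
    HasDivergence Ω m a b → ∀ {x₀ : 𝔼} {r : ℝ}, 0 < r → closedBall x₀ (3 * r) ⊆ Ω →
    m (closedBall x₀ (3 * r)) ≠ 0 →
    (∀ j k, ∫ x in closedBall x₀ (3 * r), |(1 : Matrix (Fin d) (Fin d) ℝ) j k - a j k x| ∂m
      ≤ ε * m.real (closedBall x₀ (3 * r))) →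
    (∀ k, r * ∫ x in closedBall x₀ (3 * r), |b k x| ∂m
      ≤ ε * m.real (closedBall x₀ (3 * r))) →
    ∀ {N : Set 𝔼}, MeasurableSet N → volume N = 0 →
    m (Nᶜ ∩ closedBall x₀ (3 * r)) ≤ ENNReal.ofReal ε * m (closedBall x₀ (3 * r)) →
    m (closedBall x₀ r) ≤ ENNReal.ofReal c * m (closedBall x₀ (3 * r)) := by
  obtain ⟨ε, hε, H⟩ := exists_small_mass hd hc
  refine ⟨ε, hε, fun {Ω m} _ {a b} ha hb h {x₀ r} hr hΩ h0 hs hbs {N} hN hN0 hmN => ?_⟩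
  have hM : 0 < m.real (closedBall x₀ (3 * r)) :=
    ENNReal.toReal_pos h0 (measure_ne_top _ _)
  have hself : (m (closedBall x₀ (3 * r)))⁻¹ * m (closedBall x₀ (3 * r)) = 1 :=
    ENNReal.inv_mul_cancel h0 (measure_ne_top _ _)
  have huniv : blowUp m x₀ hr univ = 1 := by
    rw [blowUp_apply, preimage_univ, univ_inter, hself]
  have : IsFiniteMeasure (blowUp m x₀ hr) := ⟨by rw [huniv]; exact ENNReal.one_lt_top⟩
  have key := H (blowUp m x₀ hr) huniv.le ?_ _ _ ?_ ?_ (almostConstant_blowUp ha h hr hΩ) ?_ ?_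
    (homothety x₀ hr '' N) ((homothety x₀ hr).measurableEmbedding.measurableSet_image.2 hN) ?_ ?_
  · rw [blowUp_apply, homothety_preimage_closedBall, one_mul, inter_eq_left.2
      (closedBall_subset_closedBall (by linarith)), ENNReal.inv_mul_le_iff h0
      (measure_ne_top _ _)] at key
    rwa [mul_comm]
  · rw [blowUp_apply, preimage_compl, homothety_preimage_closedBall, compl_inter_self,
      measure_empty, mul_zero]
  · refine fun j k => integrable_blowUp hr h0 ?_
    simp only [Homeomorph.symm_apply_apply]
    exact (integrable_const _).sub (ha j k)
  · refine fun k => integrable_blowUp hr h0 ?_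
    simp only [Homeomorph.symm_apply_apply]
    exact (hb k).const_mul _
  · intro j k
    simp only [integral_blowUp, Homeomorph.symm_apply_apply]
    rw [inv_mul_le_iff₀ hM, mul_comm _ ε]
    exact hs j k
  · intro k
    simp only [integral_blowUp, Homeomorph.symm_apply_apply, abs_mul, abs_of_pos hr,
      integral_const_mul]
    rw [mul_left_comm, inv_mul_le_iff₀ hM, mul_comm _ ε]
    exact hbs k
  · exact addHaar_image_eq_zero_of_differentiableOn_of_addHaar_eq_zero _
      ((contDiff_homothety x₀ hr).differentiable (by simp)).differentiableOn hN0
  · rw [blowUp_apply, preimage_compl, (homothety x₀ hr).injective.preimage_image,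
      ENNReal.inv_mul_le_iff h0 (measure_ne_top _ _), mul_comm _ (ENNReal.ofReal ε)]
    exact hmN

/-- At a singular point, the matrix density of a measure with absolutely continuous divergence
cannot be the identity. -/
theorem false_of_hasDivergence (hd : 0 < d) {Ω : Set 𝔼} {m : Measure 𝔼} [IsFiniteMeasure m]
    {a : Fin d → Fin d → 𝔼 → ℝ} {b : Fin d → 𝔼 → ℝ} (ha : ∀ j k, Integrable (a j k) m)
    (hb : ∀ k, Integrable (b k) m) (h : HasDivergence Ω m a b) {x₀ : 𝔼} (hΩ : Ω ∈ 𝓝 x₀)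
    (hax : ∀ j k, ∀ ε > 0, ∀ᶠ r in 𝓝[>] (0 : ℝ),
      ∫ x in closedBall x₀ r, |(1 : Matrix (Fin d) (Fin d) ℝ) j k - a j k x| ∂m
        ≤ ε * m.real (closedBall x₀ r))
    (hbx : ∀ k, ∃ C, ∀ᶠ r in 𝓝[>] (0 : ℝ),
      ∫ x in closedBall x₀ r, |b k x| ∂m ≤ C * m.real (closedBall x₀ r))
    {N : Set 𝔼} (hN : MeasurableSet N) (hN0 : volume N = 0)
    (hmN : ∀ ε > 0, ∀ᶠ r in 𝓝[>] (0 : ℝ),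
      m (Nᶜ ∩ closedBall x₀ r) ≤ ENNReal.ofReal ε * m (closedBall x₀ r))
    {c₀ : ℝ} (hc₀ : 0 < c₀)
    (hlow : ∀ᶠ r in 𝓝[>] (0 : ℝ), c₀ * r ^ d ≤ m.real (closedBall x₀ r)) : False := by
  have h3 : (0 : ℝ) < 3 ^ d := by positivity
  obtain ⟨ε, hε, H⟩ := exists_measure_closedBall_le hd (c := (3 ^ d)⁻¹ / 2) (by positivity)
  have ht : Tendsto (fun r : ℝ => 3 * r) (𝓝[>] 0) (𝓝[>] 0) := by
    refine tendsto_nhdsWithin_iff.2 ⟨?_, ?_⟩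
    · have : Tendsto (fun r : ℝ => 3 * r) (𝓝 0) (𝓝 (3 * 0)) := tendsto_id.const_mul 3
      rw [mul_zero] at this
      exact this.mono_left nhdsWithin_le_nhds
    · filter_upwards [self_mem_nhdsWithin] with r (hr : 0 < r)
      exact mul_pos three_pos hr
  have hstep : ∀ᶠ r in 𝓝[>] (0 : ℝ),
      m.real (closedBall x₀ r) ≤ (3 ^ d)⁻¹ / 2 * m.real (closedBall x₀ (3 * r)) := by
    choose C hC using hbx
    have hCε : ∀ᶠ r in 𝓝[>] (0 : ℝ), ∀ k, r * C k ≤ ε := eventually_all.2 fun k => by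
      have : Tendsto (fun r : ℝ => r * C k) (𝓝 0) (𝓝 (0 * C k)) := tendsto_id.mul_const _
      rw [zero_mul] at this
      exact (this.mono_left nhdsWithin_le_nhds).eventually (ge_mem_nhds hε)
    have hΩ' : ∀ᶠ r in 𝓝[>] (0 : ℝ), closedBall x₀ r ⊆ Ω := by
      obtain ⟨R, hR, hRΩ⟩ := nhds_basis_closedBall.mem_iff.1 hΩ
      filter_upwards [Ioo_mem_nhdsGT hR] with r hr
      exact (closedBall_subset_closedBall hr.2.le).trans hRΩ
    filter_upwards [self_mem_nhdsWithin, ht.eventually hΩ', ht.eventually hlow, hCε,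
      ht.eventually (eventually_all.2 fun j => eventually_all.2 fun k => hax j k ε hε),
      ht.eventually (eventually_all.2 hC), ht.eventually (hmN ε hε)]
      with r (hr : 0 < r) h1 h2 h4 h5 h6 h7
    have hpos : 0 < m.real (closedBall x₀ (3 * r)) := lt_of_lt_of_le (by positivity) h2
    have key := H ha hb h hr h1 (fun h0 => by simp [Measure.real, h0] at hpos) h5 (fun k => ?_)
      hN hN0 h7
    · have := ENNReal.toReal_mono (ENNReal.mul_ne_top ENNReal.ofReal_ne_top
        (measure_ne_top m _)) key
      rwa [ENNReal.toReal_mul, ENNReal.toReal_ofReal (by positivity)] at this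
    · calc r * ∫ x in closedBall x₀ (3 * r), |b k x| ∂m
          ≤ r * (C k * m.real (closedBall x₀ (3 * r))) := by gcongr; exact h6 k
        _ = r * C k * m.real (closedBall x₀ (3 * r)) := by ring
        _ ≤ _ := by gcongr; exact h4 k
  obtain ⟨R, hR : 0 < R, hRs⟩ := mem_nhdsGT_iff_exists_Ioc_subset.1 (hstep.and hlow)
  have hiter : ∀ n : ℕ, m.real (closedBall x₀ (R / 3 ^ n))
      ≤ ((3 ^ d)⁻¹ / 2) ^ n * m.real (closedBall x₀ R) := by
    intro n
    induction n with
    | zero => simp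
    | succ n ih =>
      have hmem : R / 3 ^ (n + 1) ∈ Ioc 0 R :=
        ⟨by positivity, div_le_self hR.le (one_le_pow₀ (by norm_num))⟩
      have := (hRs hmem).1
      rw [show 3 * (R / 3 ^ (n + 1)) = R / 3 ^ n by field_simp; ring] at this
      calc _ ≤ _ := this
        _ ≤ (3 ^ d)⁻¹ / 2 * (((3 ^ d)⁻¹ / 2) ^ n * m.real (closedBall x₀ R)) := by gcongr
        _ = _ := by ring
  have hle : ∀ n : ℕ, c₀ * R ^ d ≤ (1 / 2) ^ n * m.real (closedBall x₀ R) := by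
    intro n
    have hmem : R / 3 ^ n ∈ Ioc 0 R :=
      ⟨by positivity, div_le_self hR.le (one_le_pow₀ (by norm_num))⟩
    have h1 := ((hRs hmem).2 : c₀ * (R / 3 ^ n) ^ d ≤ _).trans (hiter n)
    have h2 : (0 : ℝ) < (3 ^ d) ^ n := by positivity
    calc c₀ * R ^ d = (3 ^ d) ^ n * (c₀ * (R / 3 ^ n) ^ d) := by
          rw [div_pow, ← pow_mul, ← pow_mul, mul_comm n d]
          field_simp
      _ ≤ (3 ^ d) ^ n * (((3 ^ d)⁻¹ / 2) ^ n * m.real (closedBall x₀ R)) := by gcongr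
      _ = _ := by
          rw [← mul_assoc, ← mul_pow]
          congr 2
          field_simp
  have hlim : Tendsto (fun n : ℕ => (1 / 2 : ℝ) ^ n * m.real (closedBall x₀ R)) atTop
      (𝓝 (0 * m.real (closedBall x₀ R))) :=
    (_root_.tendsto_pow_atTop_nhds_zero_of_lt_one (by norm_num) (by norm_num)).mul_const _
  rw [zero_mul] at hlim
  have := ge_of_tendsto' hlim hle
  have hpos : 0 < c₀ * R ^ d := by positivity
  linarith

theorem eventually_mul_pow_le_measureReal_closedBall {m : Measure 𝔼} [IsFiniteMeasure m]
    {x : 𝔼} (hx : Tendsto (fun r => (volume : Measure 𝔼) (closedBall x r) / m (closedBall x r))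
      (𝓝[>] 0) (𝓝 ((volume : Measure 𝔼).rnDeriv m x)))
    (hx' : (volume : Measure 𝔼).rnDeriv m x < (⊤ : ℝ≥0∞)) :
    ∃ c₀ : ℝ, 0 < c₀ ∧ ∀ᶠ r in 𝓝[>] (0 : ℝ), c₀ * r ^ d ≤ m.real (closedBall x r) := by
  set D := (volume : Measure 𝔼).rnDeriv m x
  have hD : D < D + 1 := ENNReal.lt_add_right hx'.ne one_ne_zero
  have hD' : D + 1 ≠ (⊤ : ℝ≥0∞) := ENNReal.add_ne_top.2 ⟨hx'.ne, ENNReal.one_ne_top⟩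
  have hpos : 0 < (D + 1).toReal := ENNReal.toReal_pos (by simp) hD'
  have hv : 0 < (volume : Measure 𝔼).real (ball 0 1) :=
    ENNReal.toReal_pos (measure_ball_pos _ _ one_pos).ne' measure_ball_lt_top.ne
  refine ⟨(volume : Measure 𝔼).real (ball 0 1) / (D + 1).toReal, by positivity, ?_⟩
  filter_upwards [self_mem_nhdsWithin, hx.eventually (ge_mem_nhds hD)] with r (hr : 0 < r) h
  rw [ENNReal.div_le_iff_le_mul (.inr hD') (.inl (measure_ne_top _ _)),
    Measure.addHaar_closedBall _ _ hr.le] at h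
  have := ENNReal.toReal_mono (ENNReal.mul_ne_top hD' (measure_ne_top _ _)) h
  rw [ENNReal.toReal_mul, ENNReal.toReal_mul, ENNReal.toReal_ofReal (by positivity),
    finrank_euclideanSpace_fin] at this
  rw [div_mul_eq_mul_div, div_le_iff₀ hpos, mul_comm _ (r ^ d), mul_comm _ (D + 1).toReal]
  exact this

/-- **Rigidity at singular points.** If finitely many vector-valued measures `f α • m` have
divergence `-g α • m`, then at almost every point of a Lebesgue null set their densities are
orthogonal to a common nonzero covector. -/
theorem ae_exists_annihilator {ι : Type*} [Fintype ι] [DecidableEq ι] (hd : 0 < d) {Ω : Set 𝔼}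
    (hΩ : IsOpen Ω) {m : Measure 𝔼} [IsFiniteMeasure m] {f : ι → Fin d → 𝔼 → ℝ} {g : ι → 𝔼 → ℝ}
    (hf : ∀ α j, Integrable (f α j) m) (hg : ∀ α, Integrable (g α) m)
    (h : ∀ α, ∀ φ : 𝔼 → ℝ, ContDiff ℝ ∞ φ → HasCompactSupport φ → tsupport φ ⊆ Ω →
      ∑ j, ∫ x, pderiv' j φ x * f α j x ∂m = ∫ x, φ x * g α x ∂m)
    {N : Set 𝔼} (hN : MeasurableSet N) (hN0 : volume N = 0) :
    ∀ᵐ x ∂m, x ∈ N → x ∈ Ω → ∃ w : Fin d → ℝ, w ≠ 0 ∧ ∀ α, ∑ j, w j * f α j x = 0 := by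
  have hL : ∀ {u : 𝔼 → ℝ}, Integrable u m → ∀ᵐ x ∂m, Tendsto
      (fun r => ⨍ y in closedBall x r, |u y - u x| ∂m) (𝓝[>] 0) (𝓝 0) := fun hu => by
    filter_upwards [(Besicovitch.vitaliFamily m).ae_tendsto_average_norm_sub hu.locallyIntegrable]
      with x hx
    exact hx.comp (Besicovitch.tendsto_filterAt m x)
  filter_upwards [eventually_all.2 fun α => eventually_all.2 fun j => hL (hf α j),
    eventually_all.2 fun α => hL (hg α),
    Besicovitch.ae_tendsto_measure_inter_div_of_measurableSet m hN.compl,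
    Besicovitch.ae_tendsto_rnDeriv volume m, Measure.rnDeriv_lt_top volume m]
    with x hfx hgx hNx hvx hvx' hxN hxΩ
  by_contra! hcon
  set A : Matrix ι (Fin d) ℝ := Matrix.of fun α j => f α j x with hA
  have hker : (Matrix.toLin' A).ker = ⊥ := by
    refine LinearMap.ker_eq_bot'.2 fun w hw => ?_
    by_contra hw0
    obtain ⟨α, hα⟩ := hcon w hw0
    refine hα ?_
    have := congrFun hw α
    simpa [hA, Matrix.mulVec, dotProduct, mul_comm] using this
  obtain ⟨L, hLA⟩ := LinearMap.exists_leftInverse_of_injective _ hker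
  set C := LinearMap.toMatrix' L with hC
  have hCA : C * A = 1 := by
    have := congrArg LinearMap.toMatrix' hLA
    rwa [LinearMap.toMatrix'_comp, LinearMap.toMatrix'_toLin', LinearMap.toMatrix'_id] at this
  have hCA' : ∀ j k, (1 : Matrix (Fin d) (Fin d) ℝ) j k = ∑ α, C k α * f α j x := fun j k => by
    rw [← Matrix.transpose_one, ← hCA]
    rfl
  have hintg : ∀ (u : 𝔼 → ℝ) (r : ℝ), ∫ y in closedBall x r, u y ∂m
      = (⨍ y in closedBall x r, u y ∂m) * m.real (closedBall x r) := fun u r => by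
    rw [mul_comm, ← smul_eq_mul, measure_smul_setAverage _ (measure_ne_top _ _)]
  obtain ⟨c₀, hc₀, hlow⟩ := eventually_mul_pow_le_measureReal_closedBall hvx hvx'
  refine false_of_hasDivergence hd (m := m) (a := fun j k y => ∑ α, C k α * f α j y)
    (b := fun k y => ∑ α, C k α * g α y)
    (fun j k => integrable_finsetSum _ fun α _ => (hf α j).const_mul _)
    (fun k => integrable_finsetSum _ fun α _ => (hg α).const_mul _) ?_ (hΩ.mem_nhds hxΩ)
    ?_ ?_ hN hN0 ?_ hc₀ hlow
  · intro k φ hφ hφc hφs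
    have hb : ∀ {ψ u : 𝔼 → ℝ}, Continuous ψ → HasCompactSupport ψ → Integrable u m →
        Integrable (fun y => ψ y * u y) m := fun hψ hψc hu =>
      hu.bdd_mul hψ.aestronglyMeasurable
        (.of_forall (hψc.exists_bound_of_continuous hψ).choose_spec)
    have e1 : ∀ j, ∫ y, pderiv' j φ y * ∑ α, C k α * f α j y ∂m
        = ∑ α, C k α * ∫ y, pderiv' j φ y * f α j y ∂m := fun j => by
      simp only [← integral_const_mul, Finset.mul_sum]
      rw [← integral_finsetSum _ fun α _ => (hb (contDiff_pderiv' (n := 0)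
        (hφ.of_le (by simp)) j).continuous (hasCompactSupport_pderiv' hφc j) (hf α j)).const_mul _]
      exact integral_congr_ae (.of_forall fun y => Finset.sum_congr rfl fun α _ => by ring)
    have e2 : ∫ y, φ y * ∑ α, C k α * g α y ∂m = ∑ α, C k α * ∫ y, φ y * g α y ∂m := by
      simp only [← integral_const_mul, Finset.mul_sum]
      rw [← integral_finsetSum _ fun α _ => (hb hφ.continuous hφc (hg α)).const_mul _]
      exact integral_congr_ae (.of_forall fun y => Finset.sum_congr rfl fun α _ => by ring)
    rw [e2, Finset.sum_congr rfl fun j _ => e1 j, Finset.sum_comm]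
    refine Finset.sum_congr rfl fun α _ => ?_
    rw [← h α φ hφ hφc hφs, Finset.mul_sum]
  · intro j k ε hε
    have ht : Tendsto (fun r => ∑ α, |C k α| * ⨍ y in closedBall x r, |f α j y - f α j x| ∂m)
        (𝓝[>] 0) (𝓝 (∑ α, |C k α| * 0)) :=
      tendsto_finsetSum _ fun α _ => (hfx α j).const_mul _
    simp only [mul_zero, Finset.sum_const_zero] at ht
    filter_upwards [ht.eventually (ge_mem_nhds hε)] with r hr
    have hi : ∀ α, Integrable (fun y => |C k α| * |f α j y - f α j x|)
        (m.restrict (closedBall x r)) := fun α =>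
      (((hf α j).sub (integrable_const _)).abs.const_mul _).restrict
    calc ∫ y in closedBall x r, |(1 : Matrix (Fin d) (Fin d) ℝ) j k - ∑ α, C k α * f α j y| ∂m
        ≤ ∫ y in closedBall x r, ∑ α, |C k α| * |f α j y - f α j x| ∂m := by
          refine integral_mono_of_nonneg (.of_forall fun y => abs_nonneg _)
            (integrable_finsetSum _ fun α _ => hi α) (.of_forall fun y => ?_)
          simp only
          rw [hCA', ← Finset.sum_sub_distrib]
          refine (Finset.abs_sum_le_sum_abs _ _).trans (Finset.sum_le_sum fun α _ => ?_)
          rw [← mul_sub, abs_mul, abs_sub_comm]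
      _ = (∑ α, |C k α| * ⨍ y in closedBall x r, |f α j y - f α j x| ∂m)
            * m.real (closedBall x r) := by
          rw [integral_finsetSum _ fun α _ => hi α, Finset.sum_mul]
          refine Finset.sum_congr rfl fun α _ => ?_
          rw [integral_const_mul, hintg, mul_assoc]
      _ ≤ _ := by gcongr
  · intro k
    refine ⟨∑ α, |C k α| * (1 + |g α x|), ?_⟩
    filter_upwards [eventually_all.2 fun α => (hgx α).eventually (ge_mem_nhds one_pos)] with r hr
    have hi1 : ∀ α, Integrable (fun y => |g α y - g α x|) (m.restrict (closedBall x r)) :=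
      fun α => ((hg α).sub (integrable_const _)).abs.restrict
    have hi : ∀ α, Integrable (fun y => |C k α| * (|g α y - g α x| + |g α x|))
        (m.restrict (closedBall x r)) := fun α =>
      ((hi1 α).add (integrable_const _)).const_mul _
    calc ∫ y in closedBall x r, |∑ α, C k α * g α y| ∂m
        ≤ ∫ y in closedBall x r, ∑ α, |C k α| * (|g α y - g α x| + |g α x|) ∂m := by
          refine integral_mono_of_nonneg (.of_forall fun y => abs_nonneg _)
            (integrable_finsetSum _ fun α _ => hi α) (.of_forall fun y => ?_)
          refine (Finset.abs_sum_le_sum_abs _ _).trans (Finset.sum_le_sum fun α _ => ?_)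
          rw [abs_mul]
          gcongr
          simpa using abs_add_le (g α y - g α x) (g α x)
      _ = ∑ α, |C k α| * ((⨍ y in closedBall x r, |g α y - g α x| ∂m) + |g α x|)
            * m.real (closedBall x r) := by
          rw [integral_finsetSum _ fun α _ => hi α]
          refine Finset.sum_congr rfl fun α _ => ?_
          rw [integral_const_mul, integral_add (hi1 α) (integrable_const _), hintg,
            integral_const, smul_eq_mul, measureReal_restrict_apply_univ]
          ring
      _ ≤ _ := by
          rw [Finset.sum_mul]
          gcongr with α
          exact hr α
  · intro ε hε
    rw [indicator_of_notMem (show x ∉ Nᶜ from fun hx => hx hxN)] at hNx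
    have hε' : (0 : ℝ≥0∞) < ENNReal.ofReal ε := ENNReal.ofReal_pos.2 hε
    filter_upwards [hNx.eventually (ge_mem_nhds hε')] with r hr
    rwa [ENNReal.div_le_iff_le_mul (.inr ENNReal.ofReal_ne_top) (.inr hε'.ne')] at hr

end NormalCurrent

/-- **Structure theorem for a finite family of normal currents.**
For each `i`, the `k i`-dimensional current `T_i` of finite mass on the open set
`Ω ⊆ ℝ^d` is encoded in coordinates: `ρ i = ‖T_i‖` is a finite positive measure
concentrated on `Ω`, and `F i x s` (for `s` a subset of `{1,…,d}` of cardinality `k i`)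
are the components of the orienting `k i`-vector `\vec T_i(x)` in the basis
`(e_s)`, normalized (`∑_s F_i(x,s)² = 1` for `ρ i`-a.e. `x`).  Each `T_i` is normal:
its boundary is the finite `Λ_{k_i−1}`-valued measure with components `G i · τ i`,
which in coordinates means that for every test function `φ` and every `t` with
`#t + 1 = k i`:
`∑_{j ∉ t} ε(j,t) ∫ ∂_j φ · F_i(x, t ∪ {j}) dρ_i = ∫ φ · G_i(x,t) dτ_i`.
If `μ` is a finite positive Radon measure on `Ω` with `μ ≪ ‖T_i‖` for all `i`, then for
`μ^s`-a.e. `x` there is a nonzero `1`-covector `ω` (with coordinates `ω_j`) such that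
`\vec T_i(x) ⌟ ω = 0` for every `i`, i.e. in coordinates
`∑_{j ∉ t} ε(j,t) ω_j F_i(x, t ∪ {j}) = 0` for all `t` with `#t + 1 = k i`. -/
theorem statement9 {d r : ℕ} (k : Fin r → ℕ) (hk : ∀ i, 1 ≤ k i ∧ k i ≤ d)
    (Ω : Set (EuclideanSpace ℝ (Fin d))) (hΩ : IsOpen Ω)
    (ρ : Fin r → Measure (EuclideanSpace ℝ (Fin d)))
    (hρfin : ∀ i, IsFiniteMeasure (ρ i)) (hρΩ : ∀ i, ρ i Ωᶜ = 0)
    (F : Fin r → EuclideanSpace ℝ (Fin d) → Finset (Fin d) → ℝ)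
    (hFmeas : ∀ i, AEStronglyMeasurable (F i) (ρ i))
    (hFdim : ∀ i x s, s.card ≠ k i → F i x s = 0)
    (hFpolar : ∀ i, ∀ᵐ x ∂(ρ i), ∑ s : Finset (Fin d), (F i x s) ^ 2 = 1)
    (τ : Fin r → Measure (EuclideanSpace ℝ (Fin d)))
    (hτfin : ∀ i, IsFiniteMeasure (τ i)) (hτΩ : ∀ i, τ i Ωᶜ = 0)
    (G : Fin r → EuclideanSpace ℝ (Fin d) → Finset (Fin d) → ℝ)
    (hGmeas : ∀ i, AEStronglyMeasurable (G i) (τ i))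
    (hGdim : ∀ i x t, t.card + 1 ≠ k i → G i x t = 0)
    (hGpolar : ∀ i, ∀ᵐ x ∂(τ i), ∑ s : Finset (Fin d), (G i x s) ^ 2 = 1)
    (hbd : ∀ i, ∀ φ : EuclideanSpace ℝ (Fin d) → ℝ,
      ContDiff ℝ (⊤ : ℕ∞) φ → HasCompactSupport φ → tsupport φ ⊆ Ω →
      ∀ t : Finset (Fin d), t.card + 1 = k i →
        ∑ j ∈ tᶜ, wedgeSign j t * ∫ x, pderiv' j φ x * F i x (insert j t) ∂(ρ i)
          = ∫ x, φ x * G i x t ∂(τ i))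
    (μ : Measure (EuclideanSpace ℝ (Fin d))) [IsFiniteMeasure μ] (hμΩ : μ Ωᶜ = 0)
    (hac : ∀ i, μ ≪ ρ i) :
    ∀ᵐ x ∂(μ.singularPart volume),
      ∃ ω : Fin d → ℝ, ω ≠ 0 ∧ ∀ i, ∀ t : Finset (Fin d), t.card + 1 = k i →
        ∑ j ∈ tᶜ, wedgeSign j t * ω j * F i x (insert j t) = 0 := by
  have hν := Measure.mutuallySingular_singularPart μ volume
  set ν := μ.singularPart volume
  have hνμ : ν ≤ μ := Measure.singularPart_le _ _
  obtain ⟨S, hS, hS0, hSv⟩ := hν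
  rcases d.eq_zero_or_pos with rfl | hd
  · have hSe : Sᶜ = ∅ := by
      by_contra hne
      have : Sᶜ = Set.univ := Subsingleton.eq_univ_of_nonempty (Set.nonempty_iff_ne_empty.2 hne)
      rw [this] at hSv
      exact isOpen_univ.measure_ne_zero volume Set.univ_nonempty hSv
    rw [Set.compl_empty_iff.1 hSe, Measure.measure_univ_eq_zero] at hS0
    simp [hS0]
  have hνfin : IsFiniteMeasure ν := isFiniteMeasure_of_le μ hνμ
  set m : Measure (EuclideanSpace ℝ (Fin d)) := ν + (∑ i, ρ i + ∑ i, τ i) with hm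
  have hmfin : IsFiniteMeasure m := by infer_instance
  have hνm : ν ≤ m := Measure.le_add_right le_rfl
  have hρm : ∀ i, ρ i ≪ m := fun i => Measure.absolutelyContinuous_of_le <|
    Measure.le_add_left <| Measure.le_add_right <|
      Finset.single_le_sum (f := ρ) (fun _ _ => Measure.zero_le _) (Finset.mem_univ i)
  have hτm : ∀ i, τ i ≪ m := fun i => Measure.absolutelyContinuous_of_le <|
    Measure.le_add_left <| Measure.le_add_left <|
      Finset.single_le_sum (f := τ) (fun _ _ => Measure.zero_le _) (Finset.mem_univ i)
  have hρd : ∀ i, (ρ i).HaveLebesgueDecomposition m := fun i =>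
    Measure.haveLebesgueDecomposition_of_sigmaFinite (ρ i) m
  have hτd : ∀ i, (τ i).HaveLebesgueDecomposition m := fun i =>
    Measure.haveLebesgueDecomposition_of_sigmaFinite (τ i) m
  have hintg : ∀ {σ : Measure (EuclideanSpace ℝ (Fin d))} [IsFiniteMeasure σ]
      {H : EuclideanSpace ℝ (Fin d) → Finset (Fin d) → ℝ}, AEStronglyMeasurable H σ →
      (∀ᵐ x ∂σ, ∑ s : Finset (Fin d), (H x s) ^ 2 = 1) → ∀ s, Integrable (fun x => H x s) σ := by
    intro σ _ H hH hH1 s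
    refine Integrable.of_bound ((continuous_apply s).comp_aestronglyMeasurable hH) 1 ?_
    filter_upwards [hH1] with x hx
    rw [Real.norm_eq_abs, ← sq_le_one_iff_abs_le_one, ← hx]
    exact Finset.single_le_sum (f := fun s => H x s ^ 2) (fun _ _ => sq_nonneg _)
      (Finset.mem_univ s)
  have hFi : ∀ i s, Integrable (fun x => ((ρ i).rnDeriv m x).toReal • F i x s) m := fun i s =>
    (integrable_rnDeriv_smul_iff (hρm i)).2 (hintg (hFmeas i) (hFpolar i) s)
  have hGi : ∀ i s, Integrable (fun x => ((τ i).rnDeriv m x).toReal • G i x s) m := fun i s =>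
    (integrable_rnDeriv_smul_iff (hτm i)).2 (hintg (hGmeas i) (hGpolar i) s)
  have key := NormalCurrent.ae_exists_annihilator
    (ι := {p : Fin r × Finset (Fin d) // p.2.card + 1 = k p.1}) hd hΩ (m := m)
    (f := fun α j x => if j ∈ α.1.2 then 0 else
      wedgeSign j α.1.2 * ((ρ α.1.1).rnDeriv m x).toReal • F α.1.1 x (insert j α.1.2))
    (g := fun α x => ((τ α.1.1).rnDeriv m x).toReal • G α.1.1 x α.1.2) ?_
    (fun α => hGi _ _) ?_ hS.compl hSv
  · have hpos : ∀ᵐ x ∂ν, ∀ i, 0 < (ρ i).rnDeriv m x := ae_all_iff.2 fun i =>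
      ((Measure.absolutelyContinuous_of_le hνμ).trans (hac i)).ae_le (Measure.rnDeriv_pos (hρm i))
    have htop : ∀ᵐ x ∂ν, ∀ i, (ρ i).rnDeriv m x < ⊤ := ae_all_iff.2 fun i =>
      (Measure.absolutelyContinuous_of_le hνm).ae_le (Measure.rnDeriv_lt_top (ρ i) m)
    have hΩν : ∀ᵐ x ∂ν, x ∈ Ω := by
      rw [ae_iff]
      exact le_antisymm ((hνμ _).trans hμΩ.le) zero_le
    have hSν : ∀ᵐ x ∂ν, x ∉ S := measure_eq_zero_iff_ae_notMem.1 hS0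
    filter_upwards [(Measure.absolutelyContinuous_of_le hνm).ae_le key, hpos, htop, hΩν, hSν]
      with x hx hpx htx hxΩ hxS
    obtain ⟨ω, hω, hx⟩ := hx hxS hxΩ
    refine ⟨ω, hω, fun i t ht => ?_⟩
    have hc : ((ρ i).rnDeriv m x).toReal ≠ 0 :=
      (ENNReal.toReal_pos (hpx i).ne' (htx i).ne).ne'
    refine (mul_eq_zero.1 (?_ : ((ρ i).rnDeriv m x).toReal * _ = 0)).resolve_left hc
    rw [← hx ⟨(i, t), ht⟩, Finset.mul_sum, ← Finset.sum_subset (Finset.subset_univ tᶜ)]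
    · refine Finset.sum_congr rfl fun j hj => ?_
      rw [if_neg (Finset.mem_compl.1 hj), smul_eq_mul]
      ring
    · intro j _ hj
      simp only [Finset.mem_compl, not_not] at hj
      simp [hj]
  · intro α j
    by_cases hj : j ∈ α.1.2
    · simp only [hj, if_true]
      exact integrable_zero _ _ _
    · simp only [hj, if_false]
      exact (hFi _ _).const_mul _
  · rintro ⟨⟨i, t⟩, ht⟩ φ hφ hφc hφs
    have h1 : ∫ x, φ x * ((τ i).rnDeriv m x).toReal • G i x t ∂m = ∫ x, φ x * G i x t ∂(τ i) := by
      rw [← integral_rnDeriv_smul (hτm i)]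
      simp only [smul_eq_mul, mul_left_comm]
    simp only [h1, ← hbd i φ hφ hφc hφs t ht]
    rw [← Finset.sum_subset (Finset.subset_univ tᶜ)]
    · refine Finset.sum_congr rfl fun j hj => ?_
      simp only [Finset.mem_compl.1 hj, if_false]
      rw [← integral_rnDeriv_smul (hρm i), ← integral_const_mul]
      exact integral_congr_ae (.of_forall fun x => by simp only [smul_eq_mul]; ring)
    · intro j _ hj
      simp only [Finset.mem_compl, not_not] at hj
      simp [hj]
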